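/- arXiv:1110.0090 — 3 statements merged into one kernel-verified Lean document; each statement's English description precedes it below -/
import Mathlib

section
/- Let X be a random variable with density f belonging to the integrated Pearson family IP(μ; δ, β, γ) with δ ≤ 0, let n ≥ 1, and let g ∈ H^{n,n}(X). Define S_{n,(weak)} = Σ_{i=1}^{n−1} (E[q(X)^i g^{(i)}(X)])²/(i! E[q(X)^i] ∏_{j=i−1}^{2i−2}(1−jδ)) + E[q(X)^n (g^{(n)}(X))²]/(n! ∏_{j=n−1}^{2n−2}(1−jδ)). Then S_{n−1,1}(g) ≤ S_{n,(weak)}, with equality if and only if n = 1 or g coincides on the support (α, ω) of X with a polynomial of degree at most n. -/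
open MeasureTheory ProbabilityTheory Finset Filter

noncomputable section

/-- Falling factorial `(x)_k = x (x-1) ⋯ (x-k+1)`, with `(x)_0 = 1`. -/
def fall (x : ℝ) (k : ℕ) : ℝ := ∏ j ∈ Finset.range k, (x - j)

/-- Rising factorial `[x]_k = x (x+1) ⋯ (x+k-1)`, with `[x]_0 = 1`. -/
def rise (x : ℝ) (k : ℕ) : ℝ := ∏ j ∈ Finset.range k, (x + j)

/-- The product `∏_{j=a}^{a+len-1} (1 - j δ)` of `len` consecutive factors
(an empty product is `1`). -/
def pp (δ a : ℝ) (len : ℕ) : ℝ := ∏ j ∈ Finset.range len, (1 - (a + j) * δ)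

/-- The open real interval with (possibly infinite) endpoints `α ω : EReal`. -/
def erealIoo (α ω : EReal) : Set ℝ := {x : ℝ | α < (x : EReal) ∧ (x : EReal) < ω}

/-- `g` coincides on `J` with a polynomial of degree at most `d`. -/
def IsPolyOn (g : ℝ → ℝ) (J : Set ℝ) (d : ℕ) : Prop :=
  ∃ p : Polynomial ℝ, p.natDegree ≤ d ∧ ∀ x ∈ J, g x = p.eval x

/-- The quadratic `q(x) = δ x² + β x + γ` of a Pearson family. -/
def pq (δ β γ : ℝ) : ℝ → ℝ := fun x => δ * x ^ 2 + β * x + γ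

/-- `P` is the distribution of a random variable with density `f` (w.r.t. Lebesgue
measure) belonging to the integrated Pearson family `IP(μ; δ, β, γ)`:
`μ` is the (finite) mean of `P`, `|δ|+|β|+|γ| > 0`, and
`∫_{-∞}^x (μ - t) f(t) dt = q(x) f(x)` for all `x`. -/
def IsIntegratedPearson (P : Measure ℝ) (f : ℝ → ℝ) (μ δ β γ : ℝ) : Prop :=
  IsProbabilityMeasure P ∧
  (∀ x, 0 ≤ f x) ∧
  P = volume.withDensity (fun x => ENNReal.ofReal (f x)) ∧
  Integrable (fun x : ℝ => x) P ∧
  μ = ∫ x, x ∂P ∧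
  0 < |δ| + |β| + |γ| ∧
  ∀ x : ℝ, (∫ t in Set.Iic x, (μ - t) * f t) = pq δ β γ x * f x

/-- Membership in the class `H^{m,n}(X)` for the distribution `P` of `X` with Pearson
quadratic `q` and support `J`.  Here `gd k` plays the role of the `k`-th derivative
`g^{(k)}` of `g = gd 0` on `J`.  With `ℓ = max m n`:  `g ∈ C^{ℓ-1}(J)`
(encoded by `gd k` having derivative `gd (k+1)` at every point of `J` for `k+1 < ℓ`,
and `gd (ℓ-1)` continuous on `J`), `g^{(ℓ-1)}` is absolutely continuous on `J` with
a.e. derivative `g^{(ℓ)} = gd ℓ` (encoded by the fundamental theorem of calculus: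
`gd ℓ` is locally integrable and `gd (ℓ-1)` is its integral on every subinterval of `J`),
and the moment conditions `E[q(X)^n (g^{(n)}(X))²] < ∞` and
`E[q(X)^i |g^{(i)}(X)|] < ∞` for `n < i ≤ m` hold. -/
def MemH (P : Measure ℝ) (q : ℝ → ℝ) (J : Set ℝ) (m n : ℕ) (gd : ℕ → ℝ → ℝ) : Prop :=
  (∀ k, k + 1 < max m n → ∀ x ∈ J, HasDerivAt (gd k) (gd (k + 1) x) x) ∧
  (1 ≤ max m n → ContinuousOn (gd (max m n - 1)) J) ∧
  (1 ≤ max m n → ∀ a ∈ J, ∀ b ∈ J,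
    IntervalIntegrable (gd (max m n)) volume a b ∧
      gd (max m n - 1) b - gd (max m n - 1) a = ∫ t in a..b, gd (max m n) t) ∧
  Integrable (fun x => q x ^ n * (gd n x) ^ 2) P ∧
  ∀ i, n < i → i ≤ m → Integrable (fun x => q x ^ i * |gd i x|) P

/-- The variance bound `S_{m,n}(g)` of Theorem 2.1, for a Pearson distribution `P`
with quadratic `q` and parameter `δ`. -/
def Sbound (P : Measure ℝ) (δ : ℝ) (q : ℝ → ℝ) (m n : ℕ) (gd : ℕ → ℝ → ℝ) : ℝ :=
  (∑ i ∈ Finset.Icc 1 m,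
      ((m.choose i : ℝ) * pp δ ((m : ℝ) + i) n /
          (fall ((m : ℝ) + n) i * (∫ x, q x ^ i ∂P) * pp δ ((i : ℝ) - 1) i *
            pp δ (m : ℝ) n)) *
        (∫ x, q x ^ i * gd i x ∂P) ^ 2) +
    ∑ i ∈ Finset.Icc 1 n,
      (-1 : ℝ) ^ (i - 1) *
          ((n.choose i : ℝ) / (fall ((m : ℝ) + n) i * pp δ (m : ℝ) i)) *
        ∫ x, q x ^ i * (gd i x) ^ 2 ∂P

/-- The Chernoff-type upper bound `S_{n,(weak)}` of Afendras–Papadatos. -/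
def SweakBound (P : Measure ℝ) (δ : ℝ) (q : ℝ → ℝ) (n : ℕ) (gd : ℕ → ℝ → ℝ) : ℝ :=
  (∑ i ∈ Finset.Icc 1 (n - 1),
      (∫ x, q x ^ i * gd i x ∂P) ^ 2 /
        ((i.factorial : ℝ) * (∫ x, q x ^ i ∂P) * pp δ ((i : ℝ) - 1) i)) +
    (∫ x, q x ^ n * (gd n x) ^ 2 ∂P) /
      ((n.factorial : ℝ) * pp δ ((n : ℝ) - 1) n)

/-- signed kernel -/
def sker (c x t : ℝ) : ℝ := if c < t then (if t ≤ x then 1 else 0) else (if x < t then -1 else 0)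

lemma sker_meas (c : ℝ) : Measurable (fun p : ℝ × ℝ => sker c p.1 p.2) := by
  unfold sker
  refine Measurable.ite (measurableSet_lt measurable_const measurable_snd) ?_ ?_
  · exact Measurable.ite (measurableSet_le measurable_snd measurable_fst) measurable_const measurable_const
  · exact Measurable.ite (measurableSet_lt measurable_fst measurable_snd) measurable_const measurable_const

lemma sker_enorm (c x t : ℝ) : ‖sker c x t‖ₑ = (Set.uIoc c x).indicator (fun _ => (1:ENNReal)) t := by
  unfold sker
  by_cases h1 : c < t
  · by_cases h2 : t ≤ x
    · have : t ∈ Set.uIoc c x := by rw [Set.mem_uIoc]; left; exact ⟨h1, h2⟩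
      simp [h1, h2, this]
    · have : t ∉ Set.uIoc c x := by
        rw [Set.mem_uIoc]; push Not; constructor
        · intro _; linarith [not_le.1 h2]
        · intro _; exact h1
      simp [h1, h2, this]
  · by_cases h2 : x < t
    · have : t ∈ Set.uIoc c x := by rw [Set.mem_uIoc]; right; exact ⟨h2, not_lt.1 h1⟩
      simp [h1, h2, this]
    · have : t ∉ Set.uIoc c x := by
        rw [Set.mem_uIoc]; push Not; constructor
        · intro h; exact absurd h h1
        · intro h; exact absurd h h2
      simp [h1, h2, this]

structure Ker (v V : ℝ → ℝ) (lam c : ℝ) : Prop where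
  lam_pos : 0 < lam
  v_meas : Measurable v
  v_nonneg : ∀ x, 0 ≤ v x
  int1 : Integrable (fun x => lam * (c - x) * v x)
  prim : ∀ x, ∫ t in Set.Iic x, lam * (c - t) * v t = V x
  total : ∫ t, lam * (c - t) * v t = 0

lemma Ker.tail {v V : ℝ → ℝ} {lam c : ℝ} (K : Ker v V lam c) (x : ℝ) :
    ∫ t in Set.Ioi x, lam * (t - c) * v t = V x := by
  have h := intervalIntegral.integral_Iic_add_Ioi (b := x) K.int1.integrableOn K.int1.integrableOn
  rw [K.total, K.prim] at h
  have : ∫ t in Set.Ioi x, lam * (t - c) * v t = - ∫ t in Set.Ioi x, lam * (c - t) * v t := by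
    rw [← integral_neg]; congr 1; ext t; ring
  rw [this]; linarith

lemma Ker.slice {v V : ℝ → ℝ} {lam c : ℝ} (K : Ker v V lam c) (t : ℝ) :
    ∫⁻ x, ENNReal.ofReal (lam * |x - c| * v x) * ‖sker c x t‖ₑ = ENNReal.ofReal (V t) := by
  have hl := K.lam_pos
  by_cases h1 : c < t
  · have e : ∀ x, ENNReal.ofReal (lam * |x - c| * v x) * ‖sker c x t‖ₑ =
        (Set.Ici t).indicator (fun x => ENNReal.ofReal (lam * (x - c) * v x)) x := by
      intro x
      by_cases h2 : t ≤ x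
      · simp [sker, h1, h2, abs_of_pos (show 0 < x - c by linarith)]
      · simp [sker, h1, h2]
    simp_rw [e]
    rw [lintegral_indicator measurableSet_Ici, ← ofReal_integral_eq_lintegral_ofReal,
      integral_Ici_eq_integral_Ioi, K.tail]
    · have : (fun x => lam * (x - c) * v x) = fun x => - (lam * (c - x) * v x) := by ext; ring
      rw [this]; exact K.int1.neg.integrableOn
    · filter_upwards [ae_restrict_mem measurableSet_Ici] with x hx
      have : t ≤ x := hx
      have : 0 ≤ x - c := by linarith
      have := K.v_nonneg x
      simp only [Pi.zero_apply]
      positivity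
  · have e : ∀ x, ENNReal.ofReal (lam * |x - c| * v x) * ‖sker c x t‖ₑ =
        (Set.Iio t).indicator (fun x => ENNReal.ofReal (lam * (c - x) * v x)) x := by
      intro x
      by_cases h2 : x < t
      · simp [sker, h1, h2, abs_of_neg (show x - c < 0 by linarith)]
      · simp [sker, h1, h2]
    simp_rw [e]
    rw [lintegral_indicator measurableSet_Iio, ← ofReal_integral_eq_lintegral_ofReal,
      ← integral_Iic_eq_integral_Iio, K.prim]
    · exact K.int1.integrableOn
    · filter_upwards [ae_restrict_mem measurableSet_Iio] with x hx
      have : x < t := hx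
      have : 0 ≤ c - x := by linarith
      have := K.v_nonneg x
      simp only [Pi.zero_apply]
      positivity

lemma Ker.tonelli {v V : ℝ → ℝ} {lam c : ℝ} (K : Ker v V lam c) {φ : ℝ → ENNReal}
    (hφ : AEMeasurable φ) :
    ∫⁻ t, ENNReal.ofReal (V t) * φ t =
      ∫⁻ x, ENNReal.ofReal (lam * |x - c| * v x) * ∫⁻ t, ‖sker c x t‖ₑ * φ t := by
  have hk := (sker_meas c).enorm
  have hv := K.v_meas
  have hm : Measurable (fun x => ENNReal.ofReal (lam * |x - c| * v x)) := by fun_prop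
  have h2 : ∀ x, ENNReal.ofReal (lam * |x - c| * v x) * ∫⁻ t, ‖sker c x t‖ₑ * φ t =
      ∫⁻ t, ENNReal.ofReal (lam * |x - c| * v x) * (‖sker c x t‖ₑ * φ t) := by
    intro x
    rw [lintegral_const_mul'']
    exact ((hk.comp (measurable_const.prodMk measurable_id)).aemeasurable).mul hφ
  simp_rw [h2]
  rw [lintegral_lintegral_swap]
  · refine lintegral_congr fun t => ?_
    rw [← K.slice t, ← lintegral_mul_const]
    · refine lintegral_congr fun x => ?_
      ring
    · exact hm.mul (hk.comp (measurable_id.prodMk measurable_const))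
  · refine AEMeasurable.mul (hm.comp measurable_fst).aemeasurable ?_
    exact AEMeasurable.mul hk.aemeasurable hφ.comp_snd

lemma sker_cs (c x : ℝ) {φ : ℝ → ENNReal} (hφ : AEMeasurable φ) :
    (∫⁻ t, ‖sker c x t‖ₑ * φ t) ^ 2 ≤ ENNReal.ofReal |x - c| * ∫⁻ t, ‖sker c x t‖ₑ * φ t ^ 2 := by
  have e : ∀ ψ : ℝ → ENNReal, ∫⁻ t, ‖sker c x t‖ₑ * ψ t = ∫⁻ t in Set.uIoc c x, ψ t := by
    intro ψ
    rw [← lintegral_indicator measurableSet_uIoc]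
    refine lintegral_congr fun t => ?_
    rw [sker_enorm]
    by_cases h : t ∈ Set.uIoc c x <;> simp [h]
  rw [e, e]
  have h := ENNReal.lintegral_mul_le_Lp_mul_Lq (volume.restrict (Set.uIoc c x))
    (p := 2) (q := 2) ⟨by norm_num, by norm_num, by norm_num⟩ (f := fun _ => 1) (g := φ)
    aemeasurable_const hφ.restrict
  simp only [Pi.mul_apply, one_mul, ENNReal.one_rpow, lintegral_const, Measure.restrict_apply,
    MeasurableSet.univ, Set.univ_inter, Real.volume_uIoc] at h
  calc _ ≤ _ := pow_le_pow_left₀ (by simp) h 2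
    _ = _ := by
      rw [mul_pow, ← ENNReal.rpow_natCast, ← ENNReal.rpow_natCast, ← ENNReal.rpow_mul,
        ← ENNReal.rpow_mul]
      norm_num

lemma Ker.poincare {v V : ℝ → ℝ} {lam c : ℝ} (K : Ker v V lam c) {φ : ℝ → ENNReal}
    (hφ : AEMeasurable φ) :
    ENNReal.ofReal lam * ∫⁻ x, ENNReal.ofReal (v x) * (∫⁻ t, ‖sker c x t‖ₑ * φ t) ^ 2
      ≤ ∫⁻ t, ENNReal.ofReal (V t) * φ t ^ 2 := by
  rw [K.tonelli (hφ.pow_const 2), ← lintegral_const_mul' _ _ ENNReal.ofReal_ne_top]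
  refine lintegral_mono fun x => ?_
  have := sker_cs c x hφ
  rw [ENNReal.ofReal_mul (by have := K.lam_pos; positivity), ENNReal.ofReal_mul K.lam_pos.le]
  calc _ ≤ ENNReal.ofReal lam * (ENNReal.ofReal (v x) *
      (ENNReal.ofReal |x - c| * ∫⁻ t, ‖sker c x t‖ₑ * φ t ^ 2)) := by gcongr
    _ = _ := by ring

/-- absolutely continuous pair on `J` -/
structure AC (J : Set ℝ) (h h' : ℝ → ℝ) : Prop where
  cont : ContinuousOn h J
  meas : AEStronglyMeasurable h volume
  meas' : AEStronglyMeasurable h' volume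
  ii : ∀ a ∈ J, ∀ b ∈ J, IntervalIntegrable h' volume a b
  ftc : ∀ a ∈ J, ∀ b ∈ J, h b - h a = ∫ t in a..b, h' t

lemma AC.add {J : Set ℝ} {h h' k k' : ℝ → ℝ} (H : AC J h h') (K : AC J k k') :
    AC J (fun x => h x + k x) (fun x => h' x + k' x) where
  cont := H.cont.add K.cont
  meas := H.meas.add K.meas
  meas' := H.meas'.add K.meas'
  ii := fun a ha b hb => (H.ii a ha b hb).add (K.ii a ha b hb)
  ftc := fun a ha b hb => by
    rw [intervalIntegral.integral_add (H.ii a ha b hb) (K.ii a ha b hb), ← H.ftc a ha b hb,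
      ← K.ftc a ha b hb]; ring

lemma AC.poly (J : Set ℝ) (r : Polynomial ℝ) :
    AC J (fun x => r.eval x) (fun x => r.derivative.eval x) where
  cont := r.continuous.continuousOn
  meas := r.continuous.aestronglyMeasurable
  meas' := r.derivative.continuous.aestronglyMeasurable
  ii := fun a _ b _ => r.derivative.continuous.intervalIntegrable a b
  ftc := fun a _ b _ => by
    rw [intervalIntegral.integral_eq_sub_of_hasDerivAt (fun x _ => r.hasDerivAt x)
      (r.derivative.continuous.intervalIntegrable a b)]

lemma AC.sker_eq {J : Set ℝ} {h h' : ℝ → ℝ} (H : AC J h h') {c x : ℝ} (hc : c ∈ J) (hx : x ∈ J) :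
    ∫ t, sker c x t * h' t = h x - h c := by
  rw [H.ftc c hc x hx]
  rcases le_or_gt c x with hcx | hcx
  · rw [intervalIntegral.integral_of_le hcx, ← integral_indicator measurableSet_Ioc]
    congr 1; ext t
    by_cases h1 : c < t <;> by_cases h2 : t ≤ x <;> simp [sker, Set.indicator, h1, h2]
    intro h3; linarith
  · rw [intervalIntegral.integral_of_ge hcx.le, ← integral_indicator measurableSet_Ioc,
      ← integral_neg]
    congr 1; ext t
    by_cases h1 : c < t <;> by_cases h2 : x < t <;> simp [sker, Set.indicator, h1, h2]
    · have : ¬ t ≤ c := not_le.2 h1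
      have : ¬ t ≤ x := by intro h; linarith
      simp [*]
    · have : ¬ t ≤ x := by intro h; linarith
      simp [*]

lemma AC.enorm_le {J : Set ℝ} {h h' : ℝ → ℝ} (H : AC J h h') {c x : ℝ} (hc : c ∈ J) (hx : x ∈ J) :
    ‖h x - h c‖ₑ ≤ ∫⁻ t, ‖sker c x t‖ₑ * ‖h' t‖ₑ := by
  rw [← H.sker_eq hc hx]
  refine (enorm_integral_le_lintegral_enorm _).trans (lintegral_mono fun t => ?_)
  simp [enorm_mul]

structure Lev (v V q : ℝ → ℝ) (J : Set ℝ) (lam c : ℝ) : Prop extends Ker v V lam c where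
  Jopen : IsOpen J
  Jord : J.OrdConnected
  cJ : c ∈ J
  v_pos : ∀ x ∈ J, 0 < v x
  v_zero : ∀ x ∉ J, v x = 0
  v_cont : ContinuousOn v J
  v_int : Integrable v
  q_pos : ∀ x ∈ J, 0 < q x
  q_cont : Continuous q
  V_eq : ∀ x, V x = v x * q x
  V_deriv : ∀ x ∈ J, HasDerivAt V (lam * (c - x) * v x) x

section
variable {v V q : ℝ → ℝ} {J : Set ℝ} {lam c : ℝ}

lemma ofReal_sq_eq (a b : ℝ) (ha : 0 ≤ a) : ENNReal.ofReal (a * b ^ 2) = ENNReal.ofReal a * ‖b‖ₑ ^ 2 := by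
  rw [ENNReal.ofReal_mul ha, Real.enorm_eq_ofReal_abs, ← ENNReal.ofReal_pow (abs_nonneg b), sq_abs]

lemma Lev.V_meas (L : Lev v V q J lam c) : Measurable V := by
  have : V = fun x => v x * q x := funext L.V_eq
  rw [this]; exact L.v_meas.mul L.q_cont.measurable

lemma Lev.V_pos (L : Lev v V q J lam c) : ∀ x ∈ J, 0 < V x := fun x hx => by
  rw [L.V_eq]; exact mul_pos (L.v_pos x hx) (L.q_pos x hx)

lemma Lev.V_zero (L : Lev v V q J lam c) : ∀ x ∉ J, V x = 0 := fun x hx => by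
  rw [L.V_eq, L.v_zero x hx, zero_mul]

lemma Lev.V_nonneg (L : Lev v V q J lam c) (x : ℝ) : 0 ≤ V x := by
  by_cases hx : x ∈ J
  · exact (L.V_pos x hx).le
  · exact (L.V_zero x hx).ge

lemma int_mul {w a b : ℝ → ℝ} (hw : AEStronglyMeasurable w volume) (h0 : ∀ x, 0 ≤ w x)
    (ha : AEStronglyMeasurable a volume)
    (hb : AEStronglyMeasurable b volume) (ia : Integrable (fun x => w x * a x ^ 2))
    (ib : Integrable (fun x => w x * b x ^ 2)) : Integrable (fun x => w x * a x * b x) := by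
  refine (ia.add ib).mono' ((hw.mul ha).mul hb) (Eventually.of_forall fun x => ?_)
  simp only [Real.norm_eq_abs, Pi.add_apply]
  have := h0 x
  rw [abs_le]
  constructor <;> nlinarith [mul_nonneg this (sq_nonneg (a x + b x)), mul_nonneg this (sq_nonneg (a x - b x)),
    mul_nonneg this (sq_nonneg (a x)), mul_nonneg this (sq_nonneg (b x))]

lemma Lev.lint_lt (L : Lev v V q J lam c) {h' : ℝ → ℝ} (hm : AEStronglyMeasurable h' volume)
    (hi : Integrable (fun x => V x * h' x ^ 2)) :
    ∫⁻ x, ENNReal.ofReal (v x) * (∫⁻ t, ‖sker c x t‖ₑ * ‖h' t‖ₑ) ^ 2 < ⊤ := by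
  have h1 := L.toKer.poincare hm.enorm
  have h2 : ∫⁻ t, ENNReal.ofReal (V t) * ‖h' t‖ₑ ^ 2 < ⊤ := by
    have := hi.2
    rw [hasFiniteIntegral_iff_ofReal (Eventually.of_forall fun x =>
      mul_nonneg (L.V_nonneg x) (sq_nonneg _))] at this
    refine lt_of_eq_of_lt (lintegral_congr fun x => ?_) this
    rw [ofReal_sq_eq _ _ (L.V_nonneg x)]
  have h3 := h1.trans_lt h2
  by_contra h4
  rw [not_lt, top_le_iff] at h4
  rw [h4, ENNReal.mul_top (by simpa using L.lam_pos)] at h3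
  exact lt_irrefl _ h3

lemma Lev.int_sq (L : Lev v V q J lam c) {h h' : ℝ → ℝ} (H : AC J h h')
    (hi : Integrable (fun x => V x * h' x ^ 2)) : Integrable (fun x => v x * h x ^ 2) := by
  have i1 : Integrable (fun x => v x * (h x - h c) ^ 2) := by
    refine ⟨L.v_meas.aestronglyMeasurable.mul ((H.meas.sub aestronglyMeasurable_const).pow 2), ?_⟩
    rw [hasFiniteIntegral_iff_ofReal (Eventually.of_forall fun x =>
      mul_nonneg (L.v_nonneg x) (sq_nonneg _))]
    refine lt_of_le_of_lt (lintegral_mono fun x => ?_) (L.lint_lt H.meas' hi)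
    rw [ofReal_sq_eq _ _ (L.v_nonneg x)]
    by_cases hx : x ∈ J
    · gcongr
      exact H.enorm_le L.cJ hx
    · simp [L.v_zero x hx]
  have i2 : Integrable (fun x => 2 * (v x * (h x - h c) ^ 2) + 2 * h c ^ 2 * v x) :=
    (i1.const_mul 2).add (L.v_int.const_mul _)
  refine i2.mono' (L.v_meas.aestronglyMeasurable.mul (H.meas.pow 2)) (Eventually.of_forall fun x => ?_)
  have := L.v_nonneg x
  rw [Real.norm_of_nonneg (by positivity)]
  nlinarith [mul_nonneg this (sq_nonneg (h x - h c - h c))]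

lemma Lev.int_one (L : Lev v V q J lam c) {h : ℝ → ℝ} (hm : AEStronglyMeasurable h volume)
    (hi : Integrable (fun x => v x * h x ^ 2)) : Integrable (fun x => v x * h x) := by
  have := int_mul (b := fun _ => 1) L.v_meas.aestronglyMeasurable L.v_nonneg hm aestronglyMeasurable_const hi
    (by simpa using L.v_int)
  simpa using this

/-- integration by parts -/
lemma Lev.ibp (L : Lev v V q J lam c) {h0 H H' U : ℝ → ℝ} (hm : AEStronglyMeasurable h0 volume)
    (hi : Integrable (fun x => v x * h0 x ^ 2)) (hz : ∫ x, v x * h0 x = 0)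
    (hU : ∀ x, U x = - ∫ t in Set.Iic x, v t * h0 t)
    (A : AC J H H') (hH : Integrable (fun x => V x * H' x ^ 2)) :
    Integrable (fun x => U x * H' x) ∧ ∫ x, U x * H' x = ∫ x, v x * h0 x * H x := by
  have i0 := L.int_one hm hi
  have hvm := L.v_meas.aestronglyMeasurable (μ := volume)
  have hk := sker_meas c
  have key : Integrable (fun p : ℝ × ℝ => v p.1 * h0 p.1 * (sker c p.1 p.2 * H' p.2))
      (volume.prod volume) := by
    refine ⟨?_, ?_⟩
    · exact ((hvm.mul hm).comp_fst (ν := volume)).mul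
        (hk.aestronglyMeasurable.mul (A.meas'.comp_snd (μ := volume)))
    · rw [hasFiniteIntegral_iff_enorm]
      rw [lintegral_prod]
      swap
      · exact (((hvm.mul hm).comp_fst (ν := volume)).mul
          (hk.aestronglyMeasurable.mul (A.meas'.comp_snd (μ := volume)))).enorm
      have e : ∀ x, ∫⁻ t, ‖v x * h0 x * (sker c x t * H' t)‖ₑ ≤
          ENNReal.ofReal (v x * h0 x ^ 2) +
          ENNReal.ofReal (v x) * (∫⁻ t, ‖sker c x t‖ₑ * ‖H' t‖ₑ) ^ 2 := by
        intro x
        simp_rw [enorm_mul]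
        rw [lintegral_const_mul' _ _ (ENNReal.mul_ne_top enorm_ne_top enorm_ne_top)]
        rw [ofReal_sq_eq _ _ (L.v_nonneg x), Real.enorm_of_nonneg (L.v_nonneg x), mul_assoc,
          ← mul_add]
        gcongr
        generalize (∫⁻ t, ‖sker c x t‖ₑ * ‖H' t‖ₑ) = y
        generalize ‖h0 x‖ₑ = z
        rcases le_total y z with h | h
        · refine le_trans ?_ le_self_add
          rw [sq]; gcongr
        · refine le_trans ?_ le_add_self
          rw [sq]; gcongr
      refine lt_of_le_of_lt (lintegral_mono e) ?_
      rw [lintegral_add_left']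
      · refine ENNReal.add_lt_top.2 ⟨?_, L.lint_lt A.meas' hH⟩
        have := hi.2
        rwa [hasFiniteIntegral_iff_ofReal (Eventually.of_forall fun x =>
          mul_nonneg (L.v_nonneg x) (sq_nonneg _))] at this
      · exact hi.1.aemeasurable.ennreal_ofReal
  have inner : ∀ᵐ t, (∫ x, v x * h0 x * (sker c x t * H' t)) = U t * H' t := by
    refine Eventually.of_forall fun t => ?_
    have : ∀ x, v x * h0 x * (sker c x t * H' t) = (sker c x t * (v x * h0 x)) * H' t := by
      intro x; ring
    simp_rw [this]
    rw [integral_mul_const]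
    congr 1
    rw [hU]
    by_cases h1 : c < t
    · have e : ∀ x, sker c x t * (v x * h0 x) = (Set.Ici t).indicator (fun x => v x * h0 x) x := by
        intro x
        by_cases h2 : t ≤ x <;> simp [sker, h1, h2]
      simp_rw [e]
      rw [integral_indicator measurableSet_Ici, integral_Ici_eq_integral_Ioi]
      have := intervalIntegral.integral_Iic_add_Ioi (b := t) i0.integrableOn i0.integrableOn
      linarith
    · have e : ∀ x, sker c x t * (v x * h0 x) = - (Set.Iio t).indicator (fun x => v x * h0 x) x := by
        intro x
        by_cases h2 : x < t <;> simp [sker, h1, h2]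
      simp_rw [e]
      rw [integral_neg, integral_indicator measurableSet_Iio, integral_Iic_eq_integral_Iio]
  have outer : ∀ x, (∫ t, v x * h0 x * (sker c x t * H' t)) = v x * h0 x * (H x - H c) := by
    intro x
    rw [integral_const_mul]
    by_cases hx : x ∈ J
    · rw [A.sker_eq L.cJ hx]
    · simp [L.v_zero x hx]
  refine ⟨(key.integral_prod_right).congr inner, ?_⟩
  rw [← integral_congr_ae inner, ← integral_integral_swap (f := fun x t => v x * h0 x * (sker c x t * H' t)) key]
  simp_rw [outer, mul_sub]
  rw [integral_sub, integral_mul_const, hz]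
  · ring
  · exact int_mul hvm L.v_nonneg hm A.meas hi (L.int_sq A hH)
  · exact i0.mul_const _

lemma exhaust (Jopen : IsOpen J) (cJ : c ∈ J) (φ : ℝ → ENNReal) (M : ENNReal)
    (h0 : ∀ x ∉ J, φ x = 0)
    (hb : ∀ a ∈ J, ∀ b ∈ J, a < c → c < b → ∫⁻ x in Set.Ioc a b, φ x ≤ M) : ∫⁻ x, φ x ≤ M := by
  let ι := {p : ℚ × ℚ // (p.1 : ℝ) ∈ J ∧ (p.2 : ℝ) ∈ J ∧ (p.1 : ℝ) < c ∧ c < p.2}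
  let s : ι → Set ℝ := fun p => Set.Ioc (p.1.1 : ℝ) p.1.2
  have hd : Directed (· ⊆ ·) s := by
    intro p r
    refine ⟨⟨(min p.1.1 r.1.1, max p.1.2 r.1.2), ?_, ?_, ?_, ?_⟩, ?_, ?_⟩
    · rcases min_choice p.1.1 r.1.1 with h | h <;> simp only [h]
      exacts [p.2.1, r.2.1]
    · rcases max_choice p.1.2 r.1.2 with h | h <;> simp only [h]
      exacts [p.2.2.1, r.2.2.1]
    · push_cast; exact (min_le_left _ _).trans_lt p.2.2.2.1
    · push_cast; exact p.2.2.2.2.trans_le (le_max_left _ _)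
    · apply Set.Ioc_subset_Ioc
      · push_cast; exact min_le_left _ _
      · push_cast; exact le_max_left _ _
    · apply Set.Ioc_subset_Ioc
      · push_cast; exact min_le_right _ _
      · push_cast; exact le_max_right _ _
  have hcov : J ⊆ ⋃ p, s p := by
    intro x hx
    have hmax : max x c ∈ J := by rcases max_choice x c with h | h <;> rw [h] <;> assumption
    have hmin : min x c ∈ J := by rcases min_choice x c with h | h <;> rw [h] <;> assumption
    obtain ⟨e, he, hball⟩ := Metric.isOpen_iff.1 Jopen _ hmax
    obtain ⟨e', he', hball'⟩ := Metric.isOpen_iff.1 Jopen _ hmin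
    obtain ⟨b, hb1, hb2⟩ := exists_rat_btwn (show max x c < max x c + e by linarith)
    obtain ⟨a, ha1, ha2⟩ := exists_rat_btwn (show min x c - e' < min x c by linarith)
    refine Set.mem_iUnion.2 ⟨⟨(a, b), ?_, ?_, ?_, ?_⟩, ?_, ?_⟩
    · apply hball'; rw [Metric.mem_ball, Real.dist_eq, abs_lt]; constructor <;> linarith
    · apply hball; rw [Metric.mem_ball, Real.dist_eq, abs_lt]; constructor <;> linarith
    · exact ha2.trans_le (min_le_right _ _)
    · exact (le_max_right _ _).trans_lt hb1
    · exact ha2.trans_le (min_le_left _ _)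
    · exact ((le_max_left _ _).trans_lt hb1).le
  have e1 : ∫⁻ x, φ x = ∫⁻ x in ⋃ p, s p, φ x := by
    rw [← lintegral_indicator (MeasurableSet.iUnion fun p => measurableSet_Ioc)]
    refine lintegral_congr fun x => ?_
    by_cases hx : x ∈ ⋃ p, s p
    · rw [Set.indicator_of_mem hx]
    · rw [Set.indicator_of_notMem hx, h0 x (fun h => hx (hcov h))]
  rw [e1, setLIntegral_iUnion_of_directed _ hd]
  exact iSup_le fun p => hb _ p.2.1 _ p.2.2.1 p.2.2.2.1 p.2.2.2.2

lemma cs_set (s : Set ℝ) (h0 : ℝ → ℝ) (hv : ∀ x, 0 ≤ v x) (iv : Integrable v)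
    (i1 : Integrable (fun x => v x * h0 x)) (i2 : Integrable (fun x => v x * h0 x ^ 2)) :
    (∫ x in s, v x * h0 x) ^ 2 ≤ (∫ x in s, v x) * ∫ x in s, v x * h0 x ^ 2 := by
  have h : ∀ z : ℝ, 0 ≤ (∫ x in s, v x) * (z * z) + (-2 * ∫ x in s, v x * h0 x) * z +
      ∫ x in s, v x * h0 x ^ 2 := by
    intro z
    have : 0 ≤ ∫ x in s, v x * (h0 x - z) ^ 2 :=
      integral_nonneg fun x => mul_nonneg (hv x) (sq_nonneg _)
    have e : ∫ x in s, v x * (h0 x - z) ^ 2 =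
        ∫ x in s, ((v x * (z * z) + (-2 * (v x * h0 x)) * z) + v x * h0 x ^ 2) := by
      congr 1; ext x; ring
    rw [e, integral_add, integral_add, integral_mul_const, integral_mul_const,
      integral_const_mul] at this
    · exact this
    · exact (iv.mul_const _).integrableOn
    · exact ((i1.const_mul _).mul_const _).integrableOn
    · exact ((iv.mul_const _).add ((i1.const_mul _).mul_const _)).integrableOn
    · exact i2.integrableOn
  have := discrim_le_zero h
  rw [discrim] at this
  nlinarith

end

section
variable {v V q : ℝ → ℝ} {J : Set ℝ} {lam c : ℝ}

lemma Lev.adj (L : Lev v V q J lam c) {h0 : ℝ → ℝ} (hc : ContinuousOn h0 J)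
    (hm : AEStronglyMeasurable h0 volume)
    (hi : Integrable (fun x => v x * h0 x ^ 2)) (hz : ∫ x, v x * h0 x = 0) :
    ∃ u u' : ℝ → ℝ, AC J u u' ∧ ContinuousOn u' J ∧ (∀ x ∈ J, HasDerivAt u (u' x) x) ∧
      Integrable (fun x => V x * u x ^ 2) ∧
      Integrable (fun x => V x * q x * u' x ^ 2) ∧
      lam * (∫ x, V x * u x ^ 2) + (∫ x, V x * q x * u' x ^ 2) ≤ ∫ x, v x * h0 x ^ 2 ∧
      (∀ x ∈ J, h0 x = -(q x * u' x + lam * (c - x) * u x)) ∧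
      ∀ H H' : ℝ → ℝ, AC J H H' → Integrable (fun x => V x * H' x ^ 2) →
        Integrable (fun x => V x * u x * H' x) ∧ ∫ x, V x * u x * H' x = ∫ x, v x * h0 x * H x := by
  have i0 := L.int_one hm hi
  have hl := L.lam_pos
  obtain ⟨U, hU⟩ : ∃ U : ℝ → ℝ, ∀ x, U x = - ∫ t in Set.Iic x, v t * h0 t := ⟨_, fun _ => rfl⟩
  have hUtail : ∀ x, U x = ∫ t in Set.Ioi x, v t * h0 t := by
    intro x
    have := intervalIntegral.integral_Iic_add_Ioi (b := x) i0.integrableOn i0.integrableOn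
    rw [hU]; linarith
  have hUc : ∀ x, U x = U c - ∫ t in c..x, v t * h0 t := by
    intro x
    rw [hU, hU, ← intervalIntegral.integral_Iic_sub_Iic i0.integrableOn i0.integrableOn]
    ring
  have hUd : ∀ x ∈ J, HasDerivAt U (-(v x * h0 x)) x := by
    intro x hx
    have hca : ContinuousAt (fun t => v t * h0 t) x :=
      (L.v_cont.mul hc).continuousAt (L.Jopen.mem_nhds hx)
    have := intervalIntegral.integral_hasDerivAt_right (a := c) (b := x) i0.intervalIntegrable
      (i0.aestronglyMeasurable.stronglyMeasurableAtFilter) hca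
    have e : U = fun x => U c - ∫ t in c..x, v t * h0 t := funext hUc
    rw [e]
    exact this.const_sub _
  have hUcont : Continuous U := by
    have e : U = fun x => U c - ∫ t in c..x, v t * h0 t := funext hUc
    rw [e]
    exact continuous_const.sub (intervalIntegral.continuous_primitive
      (fun a b => i0.intervalIntegrable) c)
  obtain ⟨u, hu⟩ : ∃ u : ℝ → ℝ, ∀ x, u x = U x / V x := ⟨_, fun _ => rfl⟩
  obtain ⟨u', hu'⟩ : ∃ u' : ℝ → ℝ, ∀ x, u' x = -(h0 x + lam * (c - x) * u x) / q x :=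
    ⟨_, fun _ => rfl⟩
  have hue : u = fun x => U x / V x := funext hu
  have hue' : u' = fun x => -(h0 x + lam * (c - x) * u x) / q x := funext hu'
  have hVu : ∀ x, V x * u x = U x := by
    intro x
    by_cases hx : x ∈ J
    · rw [hu]; have := (L.V_pos x hx).ne'; field_simp
    · rw [L.V_zero x hx, zero_mul, hUc]
      -- outside `J`, `U = 0`
      rw [← hUc]
      rcases lt_or_ge x c with h | h
      · rw [hU, setIntegral_eq_zero_of_forall_eq_zero, neg_zero]
        intro t ht
        have : t ∉ J := fun h2 => hx (L.Jord.out h2 L.cJ ⟨ht, h.le⟩)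
        rw [L.v_zero t this, zero_mul]
      · rw [hUtail, setIntegral_eq_zero_of_forall_eq_zero]
        intro t ht
        have : t ∉ J := fun h2 => hx (L.Jord.out L.cJ h2 ⟨h, (show x < t from ht).le⟩)
        rw [L.v_zero t this, zero_mul]
  have hud : ∀ x ∈ J, HasDerivAt u (u' x) x := by
    intro x hx
    have h1 := (hUd x hx).div (L.V_deriv x hx) (L.V_pos x hx).ne'
    rw [hue]
    refine HasDerivAt.congr_deriv h1 ?_
    rw [hu', hu, L.V_eq]
    have := (L.v_pos x hx).ne'
    have := (L.q_pos x hx).ne'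
    field_simp
    ring
  have hucont : ContinuousOn u J := fun x hx => (hud x hx).continuousAt.continuousWithinAt
  have hucont' : ContinuousOn u' J := by
    rw [hue']
    refine ContinuousOn.div ?_ L.q_cont.continuousOn fun x hx => (L.q_pos x hx).ne'
    exact (hc.add ((continuous_const.mul (continuous_const.sub continuous_id)).continuousOn.mul
      hucont)).neg
  have hum : AEStronglyMeasurable u volume := by
    rw [hue]
    exact (hUcont.measurable.div L.V_meas).aestronglyMeasurable
  have hum' : AEStronglyMeasurable u' volume := by
    rw [hue']
    exact ((hm.add ((continuous_const.mul (continuous_const.sub continuous_id)).aestronglyMeasurable.mul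
      hum)).neg.aemeasurable.div L.q_cont.measurable.aemeasurable).aestronglyMeasurable
  have hsub : ∀ a ∈ J, ∀ b ∈ J, Set.uIcc a b ⊆ J := fun a ha b hb => L.Jord.uIcc_subset ha hb
  have hAC : AC J u u' := by
    refine ⟨hucont, hum, hum', ?_, ?_⟩
    · intro a ha b hb
      exact (hucont'.mono (hsub a ha b hb)).intervalIntegrable
    · intro a ha b hb
      rw [intervalIntegral.integral_eq_sub_of_hasDerivAt
        (fun x hx => hud x (hsub a ha b hb hx))
        (hucont'.mono (hsub a ha b hb)).intervalIntegrable]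
  have hh0 : ∀ x ∈ J, h0 x = -(q x * u' x + lam * (c - x) * u x) := by
    intro x hx
    rw [hu']
    have := (L.q_pos x hx).ne'
    field_simp
    ring
  set Ψ : ℝ → ℝ := fun x => lam * (V x * u x ^ 2) + V x * q x * u' x ^ 2 with hΨ
  have hVc : ContinuousOn V J := fun x hx => (L.V_deriv x hx).continuousAt.continuousWithinAt
  have hΨc : ContinuousOn Ψ J :=
    (continuousOn_const.mul (hVc.mul (hucont.pow 2))).add
      ((hVc.mul L.q_cont.continuousOn).mul (hucont'.pow 2))
  have hqJ : ∀ x, 0 ≤ V x * q x := by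
    intro x
    by_cases hx : x ∈ J
    · exact (mul_pos (L.V_pos x hx) (L.q_pos x hx)).le
    · rw [L.V_zero x hx, zero_mul]
  have hΨ0 : ∀ x, 0 ≤ Ψ x := by
    intro x
    have := hqJ x
    have := L.V_nonneg x
    simp only [hΨ]
    positivity
  set G : ℝ → ℝ := fun x => lam * (c - x) * (V x * u x ^ 2) with hG
  have bound : ∀ a ∈ J, ∀ b ∈ J, a < c → c < b →
      ∫ x in Set.Ioc a b, Ψ x ≤ ∫ x, v x * h0 x ^ 2 := by
    intro a ha b hb hac hcb
    have hab : a ≤ b := by linarith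
    have hs := hsub a ha b hb
    have iΨ : IntervalIntegrable Ψ volume a b := (hΨc.mono hs).intervalIntegrable
    have ih : IntervalIntegrable (fun x => v x * h0 x ^ 2) volume a b := hi.intervalIntegrable
    have hGd : ∀ x ∈ Set.uIcc a b, HasDerivAt G (v x * h0 x ^ 2 - Ψ x) x := by
      intro x hx
      have hxJ := hs hx
      have h1 : HasDerivAt (fun x : ℝ => lam * (c - x)) (-lam) x := by
        have := ((hasDerivAt_id x).const_sub c).const_mul lam
        simpa using this
      have h2 := h1.mul ((L.V_deriv x hxJ).mul ((hud x hxJ).pow 2))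
      refine HasDerivAt.congr_deriv h2 ?_
      simp only [hΨ]
      rw [hh0 x hxJ]
      simp only [Pi.mul_apply, Pi.pow_apply, L.V_eq]
      push_cast
      ring
    have hF := intervalIntegral.integral_eq_sub_of_hasDerivAt hGd (ih.sub iΨ)
    rw [intervalIntegral.integral_sub ih iΨ, intervalIntegral.integral_of_le hab,
      intervalIntegral.integral_of_le hab] at hF
    have hb1 : - G b ≤ ∫ x in Set.Ioi b, v x * h0 x ^ 2 := by
      have hVb := L.V_pos b hb
      have h1 := cs_set (Set.Ioi b) h0 L.v_nonneg L.v_int i0 hi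
      rw [← hUtail] at h1
      have h2 : lam * (b - c) * ∫ x in Set.Ioi b, v x ≤ V b := by
        rw [← L.toKer.tail b, ← integral_const_mul]
        refine setIntegral_mono_on (L.v_int.const_mul _).integrableOn ?_ measurableSet_Ioi ?_
        · have : (fun x => lam * (x - c) * v x) = fun x => - (lam * (c - x) * v x) := by ext; ring
          rw [this]; exact L.int1.neg.integrableOn
        · intro x hx
          have := L.v_nonneg x
          have : b < x := hx
          gcongr
      have h3 : 0 ≤ ∫ x in Set.Ioi b, v x * h0 x ^ 2 :=
        integral_nonneg fun x => mul_nonneg (L.v_nonneg x) (sq_nonneg _)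
      have h4 : - G b = lam * (b - c) * U b ^ 2 / V b := by
        simp only [hG]; rw [hu]; field_simp; ring
      rw [h4, div_le_iff₀ hVb]
      have h5 : 0 ≤ lam * (b - c) := mul_nonneg hl.le (by linarith)
      calc _ ≤ lam * (b - c) * ((∫ x in Set.Ioi b, v x) * ∫ x in Set.Ioi b, v x * h0 x ^ 2) := by
            gcongr
        _ = (lam * (b - c) * ∫ x in Set.Ioi b, v x) * ∫ x in Set.Ioi b, v x * h0 x ^ 2 := by ring
        _ ≤ V b * ∫ x in Set.Ioi b, v x * h0 x ^ 2 := by gcongr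
        _ = _ := by ring
    have ha1 : G a ≤ ∫ x in Set.Iic a, v x * h0 x ^ 2 := by
      have hVb := L.V_pos a ha
      have h1 := cs_set (Set.Iic a) h0 L.v_nonneg L.v_int i0 hi
      have h1' : U a ^ 2 = (∫ x in Set.Iic a, v x * h0 x) ^ 2 := by rw [hU]; ring
      rw [← h1'] at h1
      have h2 : lam * (c - a) * ∫ x in Set.Iic a, v x ≤ V a := by
        rw [← L.prim a, ← integral_const_mul]
        refine setIntegral_mono_on (L.v_int.const_mul _).integrableOn L.int1.integrableOn
          measurableSet_Iic ?_
        intro x hx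
        have := L.v_nonneg x
        have : x ≤ a := hx
        gcongr
      have h3 : 0 ≤ ∫ x in Set.Iic a, v x * h0 x ^ 2 :=
        integral_nonneg fun x => mul_nonneg (L.v_nonneg x) (sq_nonneg _)
      have h4 : G a = lam * (c - a) * U a ^ 2 / V a := by
        simp only [hG]; rw [hu]; field_simp
      rw [h4, div_le_iff₀ hVb]
      have h5 : 0 ≤ lam * (c - a) := mul_nonneg hl.le (by linarith)
      calc _ ≤ lam * (c - a) * ((∫ x in Set.Iic a, v x) * ∫ x in Set.Iic a, v x * h0 x ^ 2) := by
            gcongr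
        _ = (lam * (c - a) * ∫ x in Set.Iic a, v x) * ∫ x in Set.Iic a, v x * h0 x ^ 2 := by ring
        _ ≤ V a * ∫ x in Set.Iic a, v x * h0 x ^ 2 := by gcongr
        _ = _ := by ring
    have s1 := intervalIntegral.integral_Iic_add_Ioi (b := b) hi.integrableOn hi.integrableOn
    have s2 := intervalIntegral.integral_Iic_sub_Iic (a := a) (b := b) hi.integrableOn hi.integrableOn
    rw [intervalIntegral.integral_of_le hab] at s2
    linarith
  have hΨz : ∀ x ∉ J, Ψ x = 0 := fun x hx => by simp [hΨ, L.V_zero x hx]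
  have hVm := L.V_meas.aestronglyMeasurable (μ := volume)
  have hqm := L.q_cont.aestronglyMeasurable (μ := volume)
  have hΨm : AEStronglyMeasurable Ψ volume :=
    ((hVm.mul (hum.pow 2)).const_mul lam).add ((hVm.mul hqm).mul (hum'.pow 2))
  have hM0 : 0 ≤ ∫ x, v x * h0 x ^ 2 :=
    integral_nonneg fun x => mul_nonneg (L.v_nonneg x) (sq_nonneg _)
  have lb : ∫⁻ x, ENNReal.ofReal (Ψ x) ≤ ENNReal.ofReal (∫ x, v x * h0 x ^ 2) := by
    refine exhaust L.Jopen L.cJ _ _ (fun x hx => by simp [hΨz x hx]) ?_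
    intro a ha b hb hac hcb
    rw [← ofReal_integral_eq_lintegral_ofReal]
    · exact ENNReal.ofReal_le_ofReal (bound a ha b hb hac hcb)
    · have : IntervalIntegrable Ψ volume a b := (hΨc.mono (hsub a ha b hb)).intervalIntegrable
      exact (intervalIntegrable_iff_integrableOn_Ioc_of_le (by linarith)).1 this
    · exact Eventually.of_forall hΨ0
  have iΨ : Integrable Ψ := by
    refine ⟨hΨm, ?_⟩
    rw [hasFiniteIntegral_iff_ofReal (Eventually.of_forall hΨ0)]
    exact lb.trans_lt ENNReal.ofReal_lt_top
  have lb2 : ∫ x, Ψ x ≤ ∫ x, v x * h0 x ^ 2 := by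
    rw [← ofReal_integral_eq_lintegral_ofReal iΨ (Eventually.of_forall hΨ0)] at lb
    exact (ENNReal.ofReal_le_ofReal_iff hM0).1 lb
  have j2 : Integrable (fun x => V x * q x * u' x ^ 2) := by
    refine iΨ.mono' ((hVm.mul hqm).mul (hum'.pow 2)) (Eventually.of_forall fun x => ?_)
    have := hqJ x
    have := L.V_nonneg x
    rw [Real.norm_of_nonneg (by positivity)]
    have : 0 ≤ lam * (V x * u x ^ 2) := by positivity
    simp only [hΨ]; linarith
  have j1 : Integrable (fun x => V x * u x ^ 2) := by
    have h := (iΨ.sub j2).const_mul (1 / lam)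
    refine h.congr (Eventually.of_forall fun x => ?_)
    simp only [hΨ, Pi.sub_apply]; field_simp; ring
  refine ⟨u, u', hAC, hucont', hud, j1, j2, ?_, hh0, ?_⟩
  · rw [← integral_const_mul, ← integral_add (j1.const_mul _) j2]; exact lb2
  · intro H H' A hH
    simp_rw [hVu]
    exact L.ibp hm hi hz hU A hH

end

def qP (δ β γ : ℝ) : Polynomial ℝ :=
  Polynomial.C δ * Polynomial.X ^ 2 + Polynomial.C β * Polynomial.X + Polynomial.C γ

lemma qP_eval (δ β γ x : ℝ) : (qP δ β γ).eval x = pq δ β γ x := by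
  simp [qP, pq]

lemma pq_cont (δ β γ : ℝ) : Continuous (pq δ β γ) := by unfold pq; fun_prop

def ww (f : ℝ → ℝ) (δ β γ : ℝ) (k : ℕ) (x : ℝ) : ℝ := f x * pq δ β γ x ^ k

def sP (μ δ β : ℝ) (k : ℕ) : Polynomial ℝ :=
  Polynomial.C (μ + k * β) - Polynomial.C (1 - 2 * k * δ) * Polynomial.X

def Dst (μ δ β γ : ℝ) (k : ℕ) (r : Polynomial ℝ) : Polynomial ℝ :=
  -(qP δ β γ * Polynomial.derivative r + sP μ δ β k * r)

structure PD (f : ℝ → ℝ) (μ δ β γ : ℝ) (J : Set ℝ) : Prop where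
  hδ : δ ≤ 0
  fmeas : Measurable f
  fpos : ∀ x ∈ J, 0 < f x
  f0 : ∀ x ∉ J, f x = 0
  Jopen : IsOpen J
  Jord : J.OrdConnected
  Jne : J.Nonempty
  bdry : ∃ S : Set ℝ, S.Countable ∧ ∀ x ∉ J, x ∉ S → ∀ᶠ y in nhds x, y ∉ J
  qpos : ∀ x ∈ J, 0 < pq δ β γ x
  fcont : ContinuousOn f J
  mom : ∀ r : Polynomial ℝ, Integrable (fun x => f x * r.eval x)
  prim : ∀ x : ℝ, (∫ t in Set.Iic x, (μ - t) * f t) = pq δ β γ x * f x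

section
variable {f : ℝ → ℝ} {μ δ β γ : ℝ} {J : Set ℝ}

lemma PD.int_mu (D : PD f μ δ β γ J) : Integrable (fun t => (μ - t) * f t) := by
  have := D.mom (Polynomial.C μ - Polynomial.X)
  simpa [mul_comm] using this

lemma PD.F_deriv (D : PD f μ δ β γ J) (x : ℝ) (hx : x ∈ J) :
    HasDerivAt (fun x => pq δ β γ x * f x) ((μ - x) * f x) x := by
  have i0 := D.int_mu
  have hca : ContinuousAt (fun t => (μ - t) * f t) x :=
    ((continuous_const.sub continuous_id).continuousOn.mul D.fcont).continuousAt
      (D.Jopen.mem_nhds hx)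
  have := intervalIntegral.integral_hasDerivAt_right (a := 0) (b := x) i0.intervalIntegrable
      (i0.aestronglyMeasurable.stronglyMeasurableAtFilter) hca
  have e : (fun x => pq δ β γ x * f x) =
      fun x => pq δ β γ 0 * f 0 + ∫ t in (0:ℝ)..x, (μ - t) * f t := by
    ext x
    rw [← D.prim, ← D.prim,
      ← intervalIntegral.integral_Iic_sub_Iic i0.integrableOn i0.integrableOn]
    ring
  rw [e]
  exact this.const_add _

lemma PD.F_cont (D : PD f μ δ β γ J) : Continuous (fun x => pq δ β γ x * f x) := by
  have i0 := D.int_mu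
  have e : (fun x => pq δ β γ x * f x) =
      fun x => pq δ β γ 0 * f 0 + ∫ t in (0:ℝ)..x, (μ - t) * f t := by
    ext x
    rw [← D.prim, ← D.prim,
      ← intervalIntegral.integral_Iic_sub_Iic i0.integrableOn i0.integrableOn]
    ring
  rw [e]
  exact continuous_const.add (intervalIntegral.continuous_primitive
      (fun a b => i0.intervalIntegrable) 0)

lemma PD.polyPrim (D : PD f μ δ β γ J) (r : Polynomial ℝ) :
    (∀ x, ∫ t in Set.Iic x, f t * ((Polynomial.C μ - Polynomial.X) * r +
        qP δ β γ * Polynomial.derivative r).eval t = pq δ β γ x * f x * r.eval x) ∧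
    ∫ t, f t * ((Polynomial.C μ - Polynomial.X) * r +
        qP δ β γ * Polynomial.derivative r).eval t = 0 := by
  obtain ⟨S, hS, hSb⟩ := D.bdry
  set p := ((Polynomial.C μ - Polynomial.X) * r + qP δ β γ * Polynomial.derivative r) with hp
  have ip := D.mom p
  set Φ : ℝ → ℝ := fun x => pq δ β γ x * f x * r.eval x with hΦ
  have iΦ : Integrable Φ := by
    have := D.mom (qP δ β γ * r)
    refine this.congr (Eventually.of_forall fun x => ?_)
    simp only [hΦ, Polynomial.eval_mul, qP_eval]; ring
  have cΦ : Continuous Φ := D.F_cont.mul r.continuous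
  have dΦ : ∀ x, x ∉ S → HasDerivAt Φ (f x * p.eval x) x := by
    intro x hxS
    by_cases hx : x ∈ J
    · refine HasDerivAt.congr_deriv ((D.F_deriv x hx).mul (r.hasDerivAt x)) ?_
      simp only [hp, Polynomial.eval_add, Polynomial.eval_mul, qP_eval, Polynomial.eval_sub,
        Polynomial.eval_C, Polynomial.eval_X]
      ring
    · rw [D.f0 x hx, zero_mul]
      refine (hasDerivAt_const x (0:ℝ)).congr_of_eventuallyEq ?_
      filter_upwards [hSb x hx hxS] with y hy
      simp [hΦ, D.f0 y hy]
  have ftc : ∀ a b, ∫ t in a..b, f t * p.eval t = Φ b - Φ a := fun a b =>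
    integral_eq_of_hasDerivAt_off_countable Φ _ hS cΦ.continuousOn (fun x hx => dΦ x hx.2)
      ip.intervalIntegrable
  have tbot : Tendsto Φ atBot (nhds 0) := by
    have h1 : Tendsto (fun a => Φ 0 - ∫ t in a..0, f t * p.eval t) atBot
        (nhds (Φ 0 - ∫ t in Set.Iic 0, f t * p.eval t)) :=
      tendsto_const_nhds.sub (intervalIntegral_tendsto_integral_Iic 0 ip.integrableOn tendsto_id)
    have e : (fun a => Φ 0 - ∫ t in a..0, f t * p.eval t) = Φ := by
      ext a; rw [ftc]; ring
    rw [e] at h1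
    have := IntegrableAtFilter.eq_zero_of_tendsto (μ := volume) (iΦ.integrableAtFilter _) (fun s hs => by
      rcases mem_atBot_sets.1 hs with ⟨b, hb⟩
      apply le_antisymm le_top
      rw [← Real.volume_Iic (a := b)]
      exact measure_mono hb) h1
    rwa [this] at h1
  have ttop : Tendsto Φ atTop (nhds 0) := by
    have h1 : Tendsto (fun a => Φ 0 + ∫ t in 0..a, f t * p.eval t) atTop
        (nhds (Φ 0 + ∫ t in Set.Ioi 0, f t * p.eval t)) :=
      tendsto_const_nhds.add (intervalIntegral_tendsto_integral_Ioi 0 ip.integrableOn tendsto_id)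
    have e : (fun a => Φ 0 + ∫ t in 0..a, f t * p.eval t) = Φ := by
      ext a; rw [ftc]; ring
    rw [e] at h1
    have := IntegrableAtFilter.eq_zero_of_tendsto (μ := volume) (iΦ.integrableAtFilter _) (fun s hs => by
      rcases mem_atTop_sets.1 hs with ⟨b, hb⟩
      apply le_antisymm le_top
      rw [← Real.volume_Ici (a := b)]
      exact measure_mono hb) h1
    rwa [this] at h1
  have hprim : ∀ x, ∫ t in Set.Iic x, f t * p.eval t = Φ x := by
    intro x
    have h1 := intervalIntegral_tendsto_integral_Iic x ip.integrableOn tendsto_id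
    have h2 : Tendsto (fun a => Φ x - Φ a) atBot (nhds (Φ x - 0)) := tendsto_const_nhds.sub tbot
    simp_rw [ftc] at h1
    have := tendsto_nhds_unique h1 h2
    simpa using this
  refine ⟨hprim, ?_⟩
  have h1 := intervalIntegral_tendsto_integral_Ioi 0 ip.integrableOn tendsto_id
  have h2 : Tendsto (fun a => Φ a - Φ 0) atTop (nhds (0 - Φ 0)) := ttop.sub tendsto_const_nhds
  simp_rw [ftc] at h1
  have h3 := tendsto_nhds_unique h1 h2
  have h4 := intervalIntegral.integral_Iic_add_Ioi (b := 0) ip.integrableOn ip.integrableOn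
  rw [hprim, h3] at h4
  linarith

lemma Dst_id (μ δ β γ : ℝ) (k : ℕ) (r : Polynomial ℝ) :
    (Polynomial.C μ - Polynomial.X) * (qP δ β γ ^ k * r) +
        qP δ β γ * Polynomial.derivative (qP δ β γ ^ k * r) = - (qP δ β γ ^ k * Dst μ δ β γ k r) := by
  have h1 : qP δ β γ * Polynomial.derivative (qP δ β γ ^ k) =
      (k : Polynomial ℝ) * qP δ β γ ^ k * Polynomial.derivative (qP δ β γ) := by
    cases k with
    | zero => simp
    | succ k => rw [Polynomial.derivative_pow]; simp [pow_succ]; ring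
  have h2 : Polynomial.derivative (qP δ β γ) = 2 * Polynomial.C δ * Polynomial.X + Polynomial.C β := by
    have h3 : (Polynomial.C (2:ℝ)) = 2 := map_ofNat Polynomial.C 2
    simp [qP, Polynomial.derivative_pow, h3]
    ring
  rw [Polynomial.derivative_mul, mul_add, ← mul_assoc, ← mul_assoc (qP δ β γ), h1, h2]
  unfold Dst sP
  simp only [Polynomial.C_add, Polynomial.C_mul, Polynomial.C_sub, map_natCast, Polynomial.C_1, map_ofNat]
  ring

lemma PD.dstPrim (D : PD f μ δ β γ J) (k : ℕ) (r : Polynomial ℝ) :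
    (∀ x, ww f δ β γ (k + 1) x * r.eval x =
      - ∫ t in Set.Iic x, ww f δ β γ k t * (Dst μ δ β γ k r).eval t) ∧
    ∫ t, ww f δ β γ k t * (Dst μ δ β γ k r).eval t = 0 := by
  obtain ⟨h1, h2⟩ := D.polyPrim (qP δ β γ ^ k * r)
  rw [Dst_id] at h1 h2
  have e : ∀ t, f t * (-(qP δ β γ ^ k * Dst μ δ β γ k r)).eval t =
      - (ww f δ β γ k t * (Dst μ δ β γ k r).eval t) := by
    intro t
    simp only [Polynomial.eval_neg, Polynomial.eval_mul, Polynomial.eval_pow, qP_eval, ww]; ring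
  simp_rw [e] at h1 h2
  refine ⟨fun x => ?_, ?_⟩
  · rw [← integral_neg, h1, Polynomial.eval_mul, Polynomial.eval_pow, qP_eval, ww]; ring
  · rw [integral_neg] at h2; linarith

lemma PD.ww_int (D : PD f μ δ β γ J) (k : ℕ) (r : Polynomial ℝ) :
    Integrable (fun x => ww f δ β γ k x * r.eval x) := by
  refine (D.mom (qP δ β γ ^ k * r)).congr (Eventually.of_forall fun x => ?_)
  simp only [ww, Polynomial.eval_mul, Polynomial.eval_pow, qP_eval]; ring

lemma PD.lam_pos (D : PD f μ δ β γ J) (k : ℕ) : 0 < 1 - 2 * k * δ := by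
  have := D.hδ
  have : 0 ≤ (k : ℝ) := by positivity
  nlinarith

lemma PD.lev (D : PD f μ δ β γ J) (k : ℕ) :
    Lev (ww f δ β γ k) (ww f δ β γ (k + 1)) (pq δ β γ) J (1 - 2 * k * δ)
      ((μ + k * β) / (1 - 2 * k * δ)) := by
  have hl := D.lam_pos k
  set lam := 1 - 2 * k * δ with hlam
  set c := (μ + k * β) / lam with hc
  have hs : ∀ t, lam * (c - t) = (sP μ δ β k).eval t := by
    intro t
    simp only [sP, Polynomial.eval_sub, Polynomial.eval_C, Polynomial.eval_mul, Polynomial.eval_X,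
      ← hlam, hc]
    field_simp
  have hD : ∀ t, (Dst μ δ β γ k 1).eval t = - (lam * (c - t)) := by
    intro t; rw [hs]; simp [Dst]
  have hpos : ∀ x ∈ J, 0 < ww f δ β γ k x := fun x hx =>
    mul_pos (D.fpos x hx) (pow_pos (D.qpos x hx) k)
  have hzero : ∀ x ∉ J, ww f δ β γ k x = 0 := fun x hx => by simp [ww, D.f0 x hx]
  have hnn : ∀ x, 0 ≤ ww f δ β γ k x := fun x => by
    by_cases hx : x ∈ J
    · exact (hpos x hx).le
    · exact (hzero x hx).ge
  obtain ⟨h1, h2⟩ := D.dstPrim k 1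
  have int1 : Integrable (fun x => lam * (c - x) * ww f δ β γ k x) := by
    refine (D.ww_int k (sP μ δ β k)).congr (Eventually.of_forall fun x => ?_)
    simp only [hs]; ring
  have e : ∀ t, ww f δ β γ k t * (Dst μ δ β γ k 1).eval t = - (lam * (c - t) * ww f δ β γ k t) := by
    intro t; rw [hD]; ring
  simp_rw [e, integral_neg] at h1 h2
  have total : ∫ t, lam * (c - t) * ww f δ β γ k t = 0 := by linarith
  have hcJ : c ∈ J := by
    by_contra hcn
    have hvol : 0 < volume J := D.Jopen.measure_pos _ D.Jne
    obtain ⟨z, hz⟩ := D.Jne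
    have hsupp : J ⊆ Function.support (fun t => lam * (c - t) * ww f δ β γ k t) := by
      intro t ht
      have h3 : c - t ≠ 0 := fun h => hcn (by rwa [sub_eq_zero.1 h])
      exact mul_ne_zero (mul_ne_zero hl.ne' h3) (hpos t ht).ne'
    have hne : 0 < volume (Function.support (fun t => lam * (c - t) * ww f δ β γ k t)) :=
      hvol.trans_le (measure_mono hsupp)
    rcases lt_or_ge z c with hzc | hzc
    · have hnn2 : 0 ≤ᵐ[volume] (fun t => lam * (c - t) * ww f δ β γ k t) := by
        refine Eventually.of_forall fun t => ?_
        by_cases ht : t ∈ J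
        · have : t ≤ c := by
            by_contra hh
            exact hcn (D.Jord.out hz ht ⟨hzc.le, (not_le.1 hh).le⟩)
          exact mul_nonneg (mul_nonneg hl.le (by linarith)) (hnn t)
        · simp [hzero t ht]
      have := (integral_pos_iff_support_of_nonneg_ae hnn2 int1).2 hne
      linarith
    · have hnn2 : 0 ≤ᵐ[volume] (fun t => -(lam * (c - t) * ww f δ β γ k t)) := by
        refine Eventually.of_forall fun t => ?_
        by_cases ht : t ∈ J
        · have : c ≤ t := by
            by_contra hh
            exact hcn (D.Jord.out ht hz ⟨(not_le.1 hh).le, hzc⟩)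
          have h5 : lam * (c - t) * ww f δ β γ k t ≤ 0 :=
            mul_nonpos_of_nonpos_of_nonneg (mul_nonpos_of_nonneg_of_nonpos hl.le (by linarith)) (hnn t)
          simpa using h5
        · simp [hzero t ht]
      have hne2 : 0 < volume (Function.support (fun t => -(lam * (c - t) * ww f δ β γ k t))) := by
        refine hvol.trans_le (measure_mono fun t ht => ?_)
        have := hsupp ht
        simpa using this
      have := (integral_pos_iff_support_of_nonneg_ae hnn2 int1.neg).2 hne2
      rw [integral_neg] at this
      linarith
  have hder : ∀ x ∈ J, HasDerivAt (ww f δ β γ (k + 1)) (lam * (c - x) * ww f δ β γ k x) x := by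
    intro x hx
    have hd := (D.F_deriv x hx).mul ((qP δ β γ ^ k).hasDerivAt x)
    have e2 : ww f δ β γ (k + 1) = (fun x => pq δ β γ x * f x) * fun x => (qP δ β γ ^ k).eval x := by
      ext y; simp only [ww, Pi.mul_apply, Polynomial.eval_pow, qP_eval]; ring
    rw [e2]
    refine HasDerivAt.congr_deriv hd ?_
    have hid := congrArg (Polynomial.eval x) (Dst_id μ δ β γ k 1)
    simp only [mul_one, Polynomial.eval_add, Polynomial.eval_mul, Polynomial.eval_neg, hD,
      Polynomial.eval_sub, Polynomial.eval_C, Polynomial.eval_X, Polynomial.eval_pow, qP_eval] at hid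
    simp only [ww, Polynomial.eval_pow, qP_eval]
    linear_combination f x * hid
  refine { lam_pos := hl, v_meas := ?_, v_nonneg := hnn, int1 := int1, prim := ?_, total := total,
           Jopen := D.Jopen, Jord := D.Jord, cJ := hcJ, v_pos := hpos, v_zero := hzero,
           v_cont := ?_, v_int := ?_, q_pos := D.qpos, q_cont := pq_cont _ _ _, V_eq := ?_,
           V_deriv := hder }
  · exact D.fmeas.mul ((pq_cont δ β γ).measurable.pow_const k)
  · intro x
    have := h1 x
    simp only [Polynomial.eval_one] at this
    linarith
  · exact D.fcont.mul ((pq_cont δ β γ).continuousOn.pow k)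
  · simpa using D.ww_int k 1
  · intro x; simp only [ww]; ring

end

def OP (μ δ β γ : ℝ) : ℕ → ℕ → Polynomial ℝ
  | _, 0 => 1
  | k, i + 1 => Dst μ δ β γ k (OP μ δ β γ (k + 1) i)

def lm (δ : ℝ) (k N : ℕ) : ℝ := N * (1 - (2 * k + N - 1) * δ)

def MM (f : ℝ → ℝ) (δ β γ : ℝ) : ℕ → ℕ → ℝ
  | k, 0 => ∫ x, ww f δ β γ k x
  | k, i + 1 => lm δ k (i + 1) * MM f δ β γ (k + 1) i

lemma qP_deriv (δ β γ : ℝ) :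
    Polynomial.derivative (qP δ β γ) = 2 * Polynomial.C δ * Polynomial.X + Polynomial.C β := by
  have h3 : (Polynomial.C (2:ℝ)) = 2 := map_ofNat Polynomial.C 2
  simp [qP, Polynomial.derivative_pow, h3]
  ring

lemma deriv_Dst (μ δ β γ : ℝ) (k : ℕ) (r : Polynomial ℝ) :
    Polynomial.derivative (Dst μ δ β γ k r) =
      Dst μ δ β γ (k + 1) (Polynomial.derivative r) + Polynomial.C (1 - 2 * k * δ) * r := by
  have hs : Polynomial.derivative (sP μ δ β k) = - Polynomial.C (1 - 2 * k * δ) := by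
    unfold sP
    rw [Polynomial.derivative_sub, Polynomial.derivative_C, Polynomial.derivative_C_mul,
      Polynomial.derivative_X]; ring
  unfold Dst
  rw [Polynomial.derivative_neg, Polynomial.derivative_add, Polynomial.derivative_mul,
    Polynomial.derivative_mul, hs, qP_deriv]
  unfold sP
  simp only [Polynomial.C_add, Polynomial.C_mul, Polynomial.C_sub, map_natCast, Polynomial.C_1,
    map_ofNat]
  push_cast
  ring

lemma Dst_C_mul (μ δ β γ : ℝ) (k : ℕ) (a : ℝ) (r : Polynomial ℝ) :
    Dst μ δ β γ k (Polynomial.C a * r) = Polynomial.C a * Dst μ δ β γ k r := by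
  unfold Dst; rw [Polynomial.derivative_C_mul]; ring

lemma deriv_OP (μ δ β γ : ℝ) (i : ℕ) : ∀ k, Polynomial.derivative (OP μ δ β γ k (i + 1)) =
    Polynomial.C (lm δ k (i + 1)) * OP μ δ β γ (k + 1) i := by
  induction i with
  | zero =>
    intro k
    have e : OP μ δ β γ k (0 + 1) = Dst μ δ β γ k 1 := rfl
    rw [e, deriv_Dst]
    simp [Dst, OP, lm]
  | succ i ih =>
    intro k
    rw [OP, deriv_Dst, ih, Dst_C_mul, ← OP, ← add_mul, ← Polynomial.C_add]
    congr 2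
    unfold lm; push_cast; ring

section
variable {f : ℝ → ℝ} {μ δ β γ : ℝ} {J : Set ℝ}

lemma PD.ww_meas (D : PD f μ δ β γ J) (k : ℕ) : AEStronglyMeasurable (ww f δ β γ k) volume :=
  (D.lev k).v_meas.aestronglyMeasurable

lemma PD.ww_nn (D : PD f μ δ β γ J) (k : ℕ) (x : ℝ) : 0 ≤ ww f δ β γ k x := (D.lev k).v_nonneg x

lemma PD.poly_sq (D : PD f μ δ β γ J) (k : ℕ) (r : Polynomial ℝ) :
    Integrable (fun x => ww f δ β γ k x * r.eval x ^ 2) := by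
  have := D.ww_int k (r ^ 2)
  simp_rw [Polynomial.eval_pow] at this
  exact this

lemma int3 {a b c : ℝ → ℝ} (ia : Integrable a) (ib : Integrable b) (ic : Integrable c) :
    ∫ x, (a x - b x + c x) = (∫ x, a x) - (∫ x, b x) + ∫ x, c x := by
  have h1 := integral_add (ia.sub ib) ic
  have h2 := integral_sub ia ib
  have h3 : ∫ x, (a - b) x = ∫ x, (a x - b x) := rfl
  rw [← h2, ← h3, ← h1]; rfl

lemma PD.ibp (D : PD f μ δ β γ J) {h h' : ℝ → ℝ} (A : AC J h h') (k : ℕ)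
    (hi : Integrable (fun x => ww f δ β γ (k + 1) x * h' x ^ 2)) (r : Polynomial ℝ) :
    ∫ x, ww f δ β γ k x * h x * (Dst μ δ β γ k r).eval x =
      ∫ x, ww f δ β γ (k + 1) x * h' x * r.eval x := by
  obtain ⟨h1, h2⟩ := D.dstPrim k r
  have := ((D.lev k).ibp (Dst μ δ β γ k r).continuous.aestronglyMeasurable
    (D.poly_sq k _) h2 h1 A hi).2
  calc _ = ∫ x, ww f δ β γ k x * (Dst μ δ β γ k r).eval x * h x := by
        congr 1; ext x; ring
    _ = _ := by rw [← this]; congr 1; ext x; ring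

lemma lm_pos (hδ : δ ≤ 0) (k N : ℕ) (hN : 0 < N) : 0 < lm δ k N := by
  have h1 : (1:ℝ) ≤ N := by exact_mod_cast hN
  have h2 : (0:ℝ) ≤ k := by positivity
  unfold lm
  have : 0 ≤ (2 * (k:ℝ) + N - 1) * (-δ) := mul_nonneg (by linarith) (by linarith)
  apply mul_pos (by linarith); linarith

lemma PD.W_pos (D : PD f μ δ β γ J) (k : ℕ) : 0 < ∫ x, ww f δ β γ k x := by
  rw [integral_pos_iff_support_of_nonneg_ae (Eventually.of_forall (D.ww_nn k)) (D.lev k).v_int]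
  exact (D.Jopen.measure_pos volume D.Jne).trans_le
    (measure_mono fun x hx => ((D.lev k).v_pos x hx).ne')

lemma PD.M_pos (D : PD f μ δ β γ J) (i : ℕ) : ∀ k, 0 < MM f δ β γ k i := by
  induction i with
  | zero => intro k; exact D.W_pos k
  | succ i ih => intro k; exact mul_pos (lm_pos D.hδ k _ (Nat.succ_pos i)) (ih _)

lemma PD.orth (D : PD f μ δ β γ J) (i : ℕ) : ∀ k j,
    ∫ x, ww f δ β γ k x * (OP μ δ β γ k i).eval x * (OP μ δ β γ k j).eval x =
      if i = j then MM f δ β γ k i else 0 := by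
  induction i with
  | zero =>
    intro k j
    cases j with
    | zero => simp [OP, MM]
    | succ j =>
      have := (D.dstPrim k (OP μ δ β γ (k + 1) j)).2
      simpa [OP] using this
  | succ i ih =>
    intro k j
    cases j with
    | zero =>
      have := (D.dstPrim k (OP μ δ β γ (k + 1) i)).2
      simpa [OP] using this
    | succ j =>
      have h := D.ibp (AC.poly J (OP μ δ β γ k (i + 1))) k (D.poly_sq _ _) (OP μ δ β γ (k + 1) j)
      rw [← OP] at h
      rw [h, deriv_OP]
      have e : ∀ x, ww f δ β γ (k + 1) x *
          (Polynomial.C (lm δ k (i + 1)) * OP μ δ β γ (k + 1) i).eval x *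
          (OP μ δ β γ (k + 1) j).eval x = lm δ k (i + 1) * (ww f δ β γ (k + 1) x *
          (OP μ δ β γ (k + 1) i).eval x * (OP μ δ β γ (k + 1) j).eval x) := by
        intro x; rw [Polynomial.eval_mul, Polynomial.eval_C]; ring
      simp_rw [e, integral_const_mul, ih]
      by_cases hij : i = j <;> simp [hij, MM]

/-- Fourier coefficient numerators -/
def cf (f : ℝ → ℝ) (μ δ β γ : ℝ) (k i : ℕ) (φ : ℝ → ℝ) : ℝ :=
  ∫ x, ww f δ β γ k x * φ x * (OP μ δ β γ k i).eval x

def RR (f : ℝ → ℝ) (μ δ β γ : ℝ) (N k : ℕ) (φ : ℝ → ℝ) : ℝ :=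
  (∫ x, ww f δ β γ k x * φ x ^ 2) - ∑ i ∈ range N, cf f μ δ β γ k i φ ^ 2 / MM f δ β γ k i

def prj (f : ℝ → ℝ) (μ δ β γ : ℝ) (N k : ℕ) (φ : ℝ → ℝ) : Polynomial ℝ :=
  ∑ i ∈ range N, Polynomial.C (cf f μ δ β γ k i φ / MM f δ β γ k i) * OP μ δ β γ k i

lemma PD.cf_succ (D : PD f μ δ β γ J) {h h' : ℝ → ℝ} (A : AC J h h') (k i : ℕ)
    (hi : Integrable (fun x => ww f δ β γ (k + 1) x * h' x ^ 2)) :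
    cf f μ δ β γ k (i + 1) h = cf f μ δ β γ (k + 1) i h' := by
  unfold cf
  rw [OP, D.ibp A k hi]

lemma PD.prj_deriv (D : PD f μ δ β γ J) {h h' : ℝ → ℝ} (A : AC J h h') (k N : ℕ)
    (hi : Integrable (fun x => ww f δ β γ (k + 1) x * h' x ^ 2)) :
    Polynomial.derivative (prj f μ δ β γ (N + 1) k h) = prj f μ δ β γ N (k + 1) h' := by
  unfold prj
  rw [sum_range_succ', Polynomial.derivative_add, Polynomial.derivative_sum]
  have h0 : Polynomial.derivative (Polynomial.C (cf f μ δ β γ k 0 h / MM f δ β γ k 0) *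
      OP μ δ β γ k 0) = 0 := by simp [OP]
  rw [h0, add_zero]
  refine sum_congr rfl fun i _ => ?_
  rw [Polynomial.derivative_C_mul, deriv_OP, ← mul_assoc, ← Polynomial.C_mul, D.cf_succ A k i hi]
  congr 2
  have h1 := lm_pos D.hδ k (i + 1) (Nat.succ_pos i)
  have h2 := D.M_pos i (k + 1)
  rw [MM]; field_simp

lemma PD.int_poly (D : PD f μ δ β γ J) {φ : ℝ → ℝ} (hm : AEStronglyMeasurable φ volume) (k : ℕ)
    (hi : Integrable (fun x => ww f δ β γ k x * φ x ^ 2)) (r : Polynomial ℝ) :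
    Integrable (fun x => ww f δ β γ k x * φ x * r.eval x) :=
  int_mul (D.ww_meas k) (D.ww_nn k) hm r.continuous.aestronglyMeasurable hi (D.poly_sq k r)

lemma PD.int_prj (D : PD f μ δ β γ J) {φ ψ : ℝ → ℝ} (hm : AEStronglyMeasurable ψ volume) (k N : ℕ)
    (hi : Integrable (fun x => ww f δ β γ k x * ψ x ^ 2)) :
    ∫ x, ww f δ β γ k x * ψ x * (prj f μ δ β γ N k φ).eval x =
      ∑ i ∈ range N, cf f μ δ β γ k i φ / MM f δ β γ k i * cf f μ δ β γ k i ψ := by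
  have e : ∀ x, ww f δ β γ k x * ψ x * (prj f μ δ β γ N k φ).eval x =
      ∑ i ∈ range N, cf f μ δ β γ k i φ / MM f δ β γ k i *
        (ww f δ β γ k x * ψ x * (OP μ δ β γ k i).eval x) := by
    intro x
    rw [prj, Polynomial.eval_finsetSum, mul_sum]
    refine sum_congr rfl fun i _ => ?_
    rw [Polynomial.eval_mul, Polynomial.eval_C]; ring
  simp_rw [e]
  rw [integral_finsetSum _ fun i _ => (D.int_poly hm k hi _).const_mul _]
  refine sum_congr rfl fun i _ => ?_
  rw [integral_const_mul]; rfl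

lemma PD.cf_prj (D : PD f μ δ β γ J) (φ : ℝ → ℝ) (k N j : ℕ) (hj : j < N) :
    cf f μ δ β γ k j (fun x => (prj f μ δ β γ N k φ).eval x) = cf f μ δ β γ k j φ := by
  have h := D.int_prj (φ := φ) (ψ := fun x => (OP μ δ β γ k j).eval x)
    (OP μ δ β γ k j).continuous.aestronglyMeasurable k N (D.poly_sq _ _)
  have h1 : cf f μ δ β γ k j (fun x => (prj f μ δ β γ N k φ).eval x) =
      ∫ x, ww f δ β γ k x * (OP μ δ β γ k j).eval x * (prj f μ δ β γ N k φ).eval x := by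
    unfold cf; congr 1; ext x; ring
  rw [h1, h]
  have h2 : ∀ i, cf f μ δ β γ k i (fun x => (OP μ δ β γ k j).eval x) =
      if j = i then MM f δ β γ k j else 0 := fun i => by
    unfold cf; exact D.orth j k i
  simp_rw [h2]
  simp only [mul_ite, mul_zero]
  rw [sum_ite_eq, if_pos (mem_range.2 hj)]
  exact div_mul_cancel₀ _ (D.M_pos j k).ne'

lemma PD.res (D : PD f μ δ β γ J) {φ : ℝ → ℝ} (hm : AEStronglyMeasurable φ volume) (k N : ℕ)
    (hi : Integrable (fun x => ww f δ β γ k x * φ x ^ 2)) :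
    Integrable (fun x => ww f δ β γ k x * (φ x - (prj f μ δ β γ N k φ).eval x) ^ 2) ∧
    ∫ x, ww f δ β γ k x * (φ x - (prj f μ δ β γ N k φ).eval x) ^ 2 = RR f μ δ β γ N k φ ∧
    ∀ j < N, cf f μ δ β γ k j (fun x => φ x - (prj f μ δ β γ N k φ).eval x) = 0 := by
  set p := prj f μ δ β γ N k φ with hp
  have e : ∀ x, ww f δ β γ k x * (φ x - p.eval x) ^ 2 = ww f δ β γ k x * φ x ^ 2 -
      2 * (ww f δ β γ k x * φ x * p.eval x) + ww f δ β γ k x * p.eval x * p.eval x := by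
    intro x; ring
  have i2 := (D.int_poly hm k hi p).const_mul 2
  have i3 := D.int_poly p.continuous.aestronglyMeasurable k (D.poly_sq k p) p
  have hpm : AEStronglyMeasurable (fun x => p.eval x) volume := p.continuous.aestronglyMeasurable
  refine ⟨?_, ?_, ?_⟩
  · simp_rw [e]; exact (hi.sub i2).add i3
  · simp_rw [e]
    rw [int3 hi i2 i3, integral_const_mul, hp,
      D.int_prj hm k N hi, D.int_prj (ψ := fun x => (prj f μ δ β γ N k φ).eval x) hpm k N (D.poly_sq k _)]
    have h3 : ∑ i ∈ range N, cf f μ δ β γ k i φ / MM f δ β γ k i *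
        cf f μ δ β γ k i (fun x => (prj f μ δ β γ N k φ).eval x) =
        ∑ i ∈ range N, cf f μ δ β γ k i φ ^ 2 / MM f δ β γ k i := by
      refine sum_congr rfl fun i hi' => ?_
      rw [D.cf_prj _ _ _ _ (mem_range.1 hi')]; ring
    have h4 : ∑ i ∈ range N, cf f μ δ β γ k i φ / MM f δ β γ k i * cf f μ δ β γ k i φ =
        ∑ i ∈ range N, cf f μ δ β γ k i φ ^ 2 / MM f δ β γ k i :=
      sum_congr rfl fun i _ => by ring
    rw [h3, h4, RR]; ring
  · intro j hj
    have h1 := D.cf_prj φ k N j hj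
    rw [← hp] at h1
    unfold cf at h1 ⊢
    have e2 : ∀ x, ww f δ β γ k x * (φ x - p.eval x) * (OP μ δ β γ k j).eval x =
        ww f δ β γ k x * φ x * (OP μ δ β γ k j).eval x -
        ww f δ β γ k x * p.eval x * (OP μ δ β γ k j).eval x := fun x => by ring
    simp_rw [e2]
    rw [integral_sub (D.int_poly hm k hi _) (D.int_poly hpm k (D.poly_sq k p) _), h1, sub_self]

lemma PD.KN (D : PD f μ δ β γ J) (N : ℕ) : ∀ (k : ℕ) (h h' : ℝ → ℝ), AC J h h' →
    Integrable (fun x => ww f δ β γ (k + 1) x * h' x ^ 2) →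
    (∀ j < N, cf f μ δ β γ k j h = 0) →
    lm δ k N * ∫ x, ww f δ β γ k x * h x ^ 2 ≤ ∫ x, ww f δ β γ (k + 1) x * h' x ^ 2 := by
  induction N with
  | zero =>
    intro k h h' A hi _
    simp only [lm, Nat.cast_zero, zero_mul]
    exact integral_nonneg fun x => mul_nonneg (D.ww_nn _ x) (sq_nonneg _)
  | succ N ih =>
    intro k h h' A hi hc
    have L := D.lev k
    have hs := L.int_sq A hi
    have hz : ∫ x, ww f δ β γ k x * h x = 0 := by
      have := hc 0 (Nat.succ_pos _)
      simpa [cf, OP] using this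
    obtain ⟨u, u', Au, cu', du, iu, iu', hle, -, hadj⟩ := L.adj A.cont A.meas hs hz
    have ew : ∀ x, ww f δ β γ (k + 1) x * pq δ β γ x * u' x ^ 2 = ww f δ β γ (k + 1 + 1) x * u' x ^ 2 := by
      intro x; simp only [ww]; ring
    simp_rw [ew] at iu' hle
    have hcu : ∀ j < N, cf f μ δ β γ (k + 1) j u = 0 := by
      intro j hj
      have h1 := (hadj _ _ (AC.poly J (OP μ δ β γ k (j + 1))) (D.poly_sq _ _)).2
      have h2 := hc (j + 1) (Nat.succ_lt_succ hj)
      unfold cf at h2 ⊢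
      rw [h2, deriv_OP] at h1
      have e : ∀ x, ww f δ β γ (k + 1) x * u x *
          (Polynomial.C (lm δ k (j + 1)) * OP μ δ β γ (k + 1) j).eval x =
          lm δ k (j + 1) * (ww f δ β γ (k + 1) x * u x * (OP μ δ β γ (k + 1) j).eval x) := by
        intro x; rw [Polynomial.eval_mul, Polynomial.eval_C]; ring
      simp_rw [e, integral_const_mul] at h1
      exact (mul_eq_zero.1 h1).resolve_left (lm_pos D.hδ k _ (Nat.succ_pos j)).ne'
    have h3 := ih (k + 1) u u' Au iu' hcu
    have h4 : lm δ k (N + 1) = lm δ (k + 1) N + (1 - 2 * k * δ) := by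
      unfold lm; push_cast; ring
    obtain ⟨i5, h5⟩ := hadj h h' A hi
    set Λ := lm δ k (N + 1) with hΛ
    have hΛ0 : 0 < Λ := lm_pos D.hδ k _ (Nat.succ_pos N)
    have h6 : Λ * ∫ x, ww f δ β γ (k + 1) x * u x ^ 2 ≤ ∫ x, ww f δ β γ k x * h x ^ 2 := by
      rw [h4]; linarith
    have h7 : 0 ≤ ∫ x, ww f δ β γ (k + 1) x * (h' x - Λ * u x) ^ 2 :=
      integral_nonneg fun x => mul_nonneg (D.ww_nn _ x) (sq_nonneg _)
    have e7 : ∀ x, ww f δ β γ (k + 1) x * (h' x - Λ * u x) ^ 2 =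
        ww f δ β γ (k + 1) x * h' x ^ 2 - 2 * Λ * (ww f δ β γ (k + 1) x * u x * h' x) +
        Λ ^ 2 * (ww f δ β γ (k + 1) x * u x ^ 2) := fun x => by ring
    simp_rw [e7] at h7
    rw [int3 hi (i5.const_mul _) (iu.const_mul _),
      integral_const_mul, integral_const_mul, h5] at h7
    have e8 : ∫ x, ww f δ β γ k x * h x * h x = ∫ x, ww f δ β γ k x * h x ^ 2 := by
      congr 1; ext x; ring
    rw [e8] at h7
    nlinarith [mul_le_mul_of_nonneg_left h6 hΛ0.le]

lemma AC.sub_poly {h h' : ℝ → ℝ} (A : AC J h h') (r : Polynomial ℝ) :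
    AC J (fun x => h x - r.eval x) (fun x => h' x - r.derivative.eval x) := by
  have := A.add (AC.poly J (-r))
  simpa [sub_eq_add_neg] using this

lemma PD.step (D : PD f μ δ β γ J) (N k : ℕ) {h h' : ℝ → ℝ} (A : AC J h h')
    (hi : Integrable (fun x => ww f δ β γ (k + 1) x * h' x ^ 2)) :
    lm δ k (N + 1) * RR f μ δ β γ (N + 1) k h ≤ RR f μ δ β γ N (k + 1) h' := by
  have hs := (D.lev k).int_sq A hi
  obtain ⟨-, r1, r2⟩ := D.res A.meas k (N + 1) hs
  obtain ⟨s0, s1, -⟩ := D.res A.meas' (k + 1) N hi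
  have A2 := A.sub_poly (prj f μ δ β γ (N + 1) k h)
  rw [D.prj_deriv A k N hi] at A2
  have := D.KN (N + 1) k _ _ A2 s0 r2
  rwa [r1, s1] at this

end

section
variable {v V q : ℝ → ℝ} {J : Set ℝ} {lam c : ℝ}

lemma Lev.eq_case (L : Lev v V q J lam c) {h h' : ℝ → ℝ} (A : AC J h h')
    (hi : Integrable (fun x => V x * h' x ^ 2)) (hz : ∫ x, v x * h x = 0)
    (heq : ∫ x, V x * h' x ^ 2 ≤ lam * ∫ x, v x * h x ^ 2) :
    ∃ a b : ℝ, ∀ x ∈ J, h x = a * x + b := by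
  have hs := L.int_sq A hi
  obtain ⟨u, u', Au, cu', du, iu, iu', hle, hform, hadj⟩ := L.adj A.cont A.meas hs hz
  obtain ⟨i5, h5⟩ := hadj h h' A hi
  have h7 : 0 ≤ ∫ x, V x * (h' x - lam * u x) ^ 2 :=
    integral_nonneg fun x => mul_nonneg (L.V_nonneg x) (sq_nonneg _)
  have e7 : ∀ x, V x * (h' x - lam * u x) ^ 2 =
      V x * h' x ^ 2 - 2 * lam * (V x * u x * h' x) + lam ^ 2 * (V x * u x ^ 2) := fun x => by ring
  simp_rw [e7] at h7
  rw [int3 hi (i5.const_mul _) (iu.const_mul _), integral_const_mul, integral_const_mul, h5] at h7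
  have e8 : ∫ x, v x * h x * h x = ∫ x, v x * h x ^ 2 := by
    congr 1; ext x; ring
  rw [e8] at h7
  have hl := L.lam_pos
  have h9 : lam * ∫ x, v x * h x ^ 2 ≤ lam * (lam * ∫ x, V x * u x ^ 2) := by nlinarith
  have h10 := le_of_mul_le_mul_left h9 hl
  have nn : ∀ x, 0 ≤ V x * q x * u' x ^ 2 := by
    intro x
    by_cases hx : x ∈ J
    · exact mul_nonneg (mul_nonneg (L.V_nonneg x) (L.q_pos x hx).le) (sq_nonneg _)
    · simp [L.V_zero x hx]
  have h11 : ∫ x, V x * q x * u' x ^ 2 = 0 :=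
    le_antisymm (by linarith) (integral_nonneg nn)
  rw [integral_eq_zero_iff_of_nonneg nn iu'] at h11
  have h12 : u' =ᵐ[volume.restrict J] 0 := by
    rw [EventuallyEq, ae_restrict_iff' L.Jopen.measurableSet]
    filter_upwards [h11] with x hx hxJ
    have h13 : V x * q x ≠ 0 := (mul_pos (L.V_pos x hxJ) (L.q_pos x hxJ)).ne'
    have : u' x ^ 2 = 0 := (mul_eq_zero.1 hx).resolve_left h13
    exact pow_eq_zero_iff (two_ne_zero) |>.1 this
  have h13 : Set.EqOn u' 0 J :=
    Measure.eqOn_open_of_ae_eq h12 L.Jopen cu' continuousOn_const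
  have h14 : ∀ x ∈ J, u x = u c := by
    intro x hx
    have h15 := Au.ftc c L.cJ x hx
    rw [intervalIntegral.integral_congr (g := fun _ => 0) (fun t ht => h13 (L.Jord.uIcc_subset L.cJ hx ht))]
      at h15
    simp at h15; linarith
  refine ⟨lam * u c, - lam * c * u c, fun x hx => ?_⟩
  rw [hform x hx, h13 hx, h14 x hx]; simp; ring
end

section
variable {f : ℝ → ℝ} {μ δ β γ : ℝ} {J : Set ℝ}

def Bq (δ : ℝ) (k N : ℕ) : ℝ := ∏ l ∈ range N, lm δ (k + l) (N - l)

lemma Bq_pos (hδ : δ ≤ 0) (k N : ℕ) : 0 < Bq δ k N :=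
  prod_pos fun l hl => lm_pos hδ _ _ (Nat.sub_pos_of_lt (mem_range.1 hl))

lemma MM_eq (f : ℝ → ℝ) (i : ℕ) : ∀ k, MM f δ β γ k i = Bq δ k i * ∫ x, ww f δ β γ (k + i) x := by
  induction i with
  | zero => intro k; simp [MM, Bq]
  | succ i ih =>
    intro k
    rw [MM, ih, Bq, Bq, prod_range_succ']
    have : ∏ l ∈ range i, lm δ (k + (l + 1)) (i + 1 - (l + 1)) =
        ∏ l ∈ range i, lm δ (k + 1 + l) (i - l) := by
      refine prod_congr rfl fun l _ => ?_
      rw [Nat.add_sub_add_right, add_assoc, add_comm 1 l]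
    rw [this]
    have e : k + 1 + i = k + (i + 1) := by ring
    rw [e]
    simp only [add_zero, Nat.sub_zero]; ring

lemma PD.chain (D : PD f μ δ β γ J) (k : ℕ) (ψ : ℕ → ℝ → ℝ) (j : ℕ)
    (A : ∀ l < j, AC J (ψ l) (ψ (l + 1)))
    (hi : ∀ l < j, Integrable (fun x => ww f δ β γ (k + l + 1) x * ψ (l + 1) x ^ 2)) :
    ∀ N, (∏ l ∈ range j, lm δ (k + l) (N + j - l)) * RR f μ δ β γ (N + j) k (ψ 0) ≤
      RR f μ δ β γ N (k + j) (ψ j) := by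
  induction j with
  | zero => intro N; simp
  | succ j ih =>
    intro N
    have h1 := ih (fun l hl => A l (hl.trans (Nat.lt_succ_self j)))
      (fun l hl => hi l (hl.trans (Nat.lt_succ_self j))) (N + 1)
    have h2 := D.step N (k + j) (A j (Nat.lt_succ_self j)) (hi j (Nat.lt_succ_self j))
    have h3 := lm_pos D.hδ (k + j) (N + 1) (Nat.succ_pos N)
    have e : N + 1 + j = N + (j + 1) := by ring
    rw [e] at h1
    rw [prod_range_succ]
    have e2 : N + (j + 1) - j = N + 1 := by omega
    rw [e2]
    calc _ = lm δ (k + j) (N + 1) * ((∏ l ∈ range j, lm δ (k + l) (N + (j + 1) - l)) *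
            RR f μ δ β γ (N + (j + 1)) k (ψ 0)) := by ring
      _ ≤ lm δ (k + j) (N + 1) * RR f μ δ β γ (N + 1) (k + j) (ψ j) :=
          mul_le_mul_of_nonneg_left h1 h3.le
      _ ≤ _ := h2

lemma PD.down (D : PD f μ δ β γ J) (k : ℕ) (ψ : ℕ → ℝ → ℝ) (N : ℕ)
    (A : ∀ l < N, AC J (ψ l) (ψ (l + 1)))
    (hi : Integrable (fun x => ww f δ β γ (k + N) x * ψ N x ^ 2)) :
    ∀ l ≤ N, Integrable (fun x => ww f δ β γ (k + l) x * ψ l x ^ 2) := by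
  intro l hl
  induction hl using Nat.decreasingInduction with
  | self => exact hi
  | of_succ l hl ih => exact (D.lev (k + l)).int_sq (A l hl) ih

lemma RR_zero (f : ℝ → ℝ) (k : ℕ) (φ : ℝ → ℝ) :
    RR f μ δ β γ 0 k φ = ∫ x, ww f δ β γ k x * φ x ^ 2 := by simp [RR]

lemma PD.core_le (D : PD f μ δ β γ J) (k : ℕ) (ψ : ℕ → ℝ → ℝ) (N : ℕ)
    (A : ∀ l < N, AC J (ψ l) (ψ (l + 1)))
    (hi : Integrable (fun x => ww f δ β γ (k + N) x * ψ N x ^ 2)) :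
    Bq δ k N * RR f μ δ β γ N k (ψ 0) ≤ ∫ x, ww f δ β γ (k + N) x * ψ N x ^ 2 := by
  have h := D.chain k ψ N A (fun l hl => D.down k ψ N A hi (l + 1) hl) 0
  simp only [zero_add] at h
  rwa [RR_zero] at h

lemma PD.core_eq (D : PD f μ δ β γ J) (k : ℕ) (ψ : ℕ → ℝ → ℝ) (M : ℕ)
    (A : ∀ l < M + 1, AC J (ψ l) (ψ (l + 1)))
    (hi : Integrable (fun x => ww f δ β γ (k + (M + 1)) x * ψ (M + 1) x ^ 2))
    (heq : ∫ x, ww f δ β γ (k + (M + 1)) x * ψ (M + 1) x ^ 2 ≤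
      Bq δ k (M + 1) * RR f μ δ β γ (M + 1) k (ψ 0)) :
    ∃ a b : ℝ, ∀ x ∈ J, ψ M x = a * x + b := by
  have hd := D.down k ψ (M + 1) A hi
  have h := D.chain k ψ M (fun l hl => A l (hl.trans (Nat.lt_succ_self M)))
    (fun l hl => hd (l + 1) (by omega)) 1
  have hl := lm_pos D.hδ (k + M) 1 one_pos
  have e : 1 + M = M + 1 := by ring
  rw [e] at h
  rw [Bq, prod_range_succ] at heq
  have e2 : M + 1 - M = 1 := by omega
  rw [e2] at heq
  have AM := A M (Nat.lt_succ_self M)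
  have hs := hd M (Nat.le_succ M)
  obtain ⟨-, r1, r2⟩ := D.res (μ := μ) AM.meas (k + M) 1 hs
  have A2 := AM.sub_poly (prj f μ δ β γ 1 (k + M) (ψ M))
  have hp := D.prj_deriv AM (k + M) 0 hi
  rw [zero_add] at hp
  rw [hp] at A2
  have e3 : ∀ x, ψ (M + 1) x - (prj f μ δ β γ 0 (k + M + 1) (ψ (M + 1))).eval x = ψ (M + 1) x := by
    intro x; simp [prj]
  simp_rw [e3] at A2
  have hz : ∫ x, ww f δ β γ (k + M) x * (ψ M x - (prj f μ δ β γ 1 (k + M) (ψ M)).eval x) = 0 := by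
    have := r2 0 one_pos
    simpa [cf, OP] using this
  have h4 : lm δ (k + M) 1 = 1 - 2 * ((k + M : ℕ) : ℝ) * δ := by
    unfold lm; push_cast; ring
  obtain ⟨a, b, hab⟩ := (D.lev (k + M)).eq_case A2 hi hz (by
    rw [r1, ← h4]
    refine heq.trans ?_
    calc _ = lm δ (k + M) 1 * ((∏ l ∈ range M, lm δ (k + l) (M + 1 - l)) *
            RR f μ δ β γ (M + 1) k (ψ 0)) := by ring
      _ ≤ _ := mul_le_mul_of_nonneg_left h hl.le)
  refine ⟨a, b + cf f μ δ β γ (k + M) 0 (ψ M) / MM f δ β γ (k + M) 0, fun x hx => ?_⟩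
  have := hab x hx
  simp [prj, OP] at this
  linarith

lemma PD.int_congr (D : PD f μ δ β γ J) (k : ℕ) {a b : ℝ → ℝ}
    (h : ∀ᵐ x, x ∈ J → a x = b x) : ∫ x, ww f δ β γ k x * a x = ∫ x, ww f δ β γ k x * b x := by
  refine integral_congr_ae ?_
  filter_upwards [h] with x hx
  by_cases hxJ : x ∈ J
  · rw [hx hxJ]
  · rw [(D.lev k).v_zero x hxJ]; ring

lemma PD.core_poly (D : PD f μ δ β γ J) (k : ℕ) (ψ : ℕ → ℝ → ℝ) (N : ℕ) (p : Polynomial ℝ)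
    (hp : p.natDegree ≤ N) (h0 : ∀ᵐ x, x ∈ J → ψ 0 x = p.eval x)
    (hN : ∀ᵐ x, x ∈ J → ψ N x = (Polynomial.derivative^[N] p).eval x) :
    ∫ x, ww f δ β γ (k + N) x * ψ N x ^ 2 ≤ Bq δ k N * RR f μ δ β γ N k (ψ 0) := by
  set P : ℕ → ℝ → ℝ := fun l x => (Polynomial.derivative^[l] p).eval x with hP
  have AP : ∀ l, AC J (P l) (P (l + 1)) := fun l => by
    have := AC.poly J (Polynomial.derivative^[l] p)
    simpa only [hP, Function.iterate_succ_apply'] using this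
  have h3 : 0 ≤ RR f μ δ β γ (N + 1) k (P 0) := by
    obtain ⟨-, r1, -⟩ := D.res (AP 0).meas k (N + 1) (D.poly_sq k _)
    rw [← r1]
    exact integral_nonneg fun x => mul_nonneg (D.ww_nn _ x) (sq_nonneg _)
  have hcfN : ∀ i l m, cf f μ δ β γ m i (P l) = cf f μ δ β γ (m + i) 0 (P (l + i)) := by
    intro i
    induction i with
    | zero => intro l m; rfl
    | succ i ih =>
      intro l m
      rw [D.cf_succ (AP l) m i (D.poly_sq _ _), ih]
      congr 1 <;> ring_nf
  have hconst : ∃ a : ℝ, Polynomial.derivative^[N] p = Polynomial.C a := by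
    refine ⟨_, Polynomial.eq_C_of_natDegree_le_zero ?_⟩
    exact (Polynomial.natDegree_iterate_derivative p N).trans (by omega)
  obtain ⟨a, ha⟩ := hconst
  have hW := D.W_pos (k + N)
  have hB := Bq_pos D.hδ k N
  have h4 : cf f μ δ β γ k N (P 0) = a * ∫ x, ww f δ β γ (k + N) x := by
    rw [hcfN, zero_add, cf]
    simp only [hP, ha, OP, Polynomial.eval_C, Polynomial.eval_one, mul_one]
    rw [integral_mul_const]; ring
  have h5 : ∫ x, ww f δ β γ (k + N) x * ψ N x ^ 2 = a ^ 2 * ∫ x, ww f δ β γ (k + N) x := by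
    rw [D.int_congr (k + N) (b := fun _ => a ^ 2), integral_mul_const, mul_comm]
    filter_upwards [hN] with x hx hxJ
    rw [hx hxJ, ha, Polynomial.eval_C]
  have h6 : RR f μ δ β γ N k (ψ 0) = RR f μ δ β γ N k (P 0) := by
    unfold RR
    congr 1
    · refine D.int_congr k ?_
      filter_upwards [h0] with x hx hxJ
      rw [hx hxJ]; rfl
    · refine sum_congr rfl fun i _ => ?_
      congr 2
      unfold cf
      simp_rw [mul_assoc]
      refine D.int_congr k ?_
      filter_upwards [h0] with x hx hxJ
      rw [hx hxJ]; rfl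
  have h7 : RR f μ δ β γ (N + 1) k (P 0) = RR f μ δ β γ N k (P 0) -
      cf f μ δ β γ k N (P 0) ^ 2 / MM f δ β γ k N := by
    unfold RR; rw [sum_range_succ]; ring
  rw [h7, h4, MM_eq, ← h6] at h3
  rw [h5]
  have h8 : (a * ∫ x, ww f δ β γ (k + N) x) ^ 2 / (Bq δ k N * ∫ x, ww f δ β γ (k + N) x) =
      a ^ 2 * (∫ x, ww f δ β γ (k + N) x) / Bq δ k N := by
    field_simp
  rw [h8, sub_nonneg, div_le_iff₀ hB] at h3
  linarith

lemma PD.cf_iter (D : PD f μ δ β γ J) (k : ℕ) (ψ : ℕ → ℝ → ℝ) (N : ℕ)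
    (A : ∀ l < N, AC J (ψ l) (ψ (l + 1)))
    (hi : Integrable (fun x => ww f δ β γ (k + N) x * ψ N x ^ 2)) :
    ∀ i ≤ N, cf f μ δ β γ k i (ψ 0) = ∫ x, ww f δ β γ (k + i) x * ψ i x := by
  have hd := D.down k ψ N A hi
  have key : ∀ i l, l + i ≤ N → cf f μ δ β γ (k + l) i (ψ l) =
      cf f μ δ β γ (k + (l + i)) 0 (ψ (l + i)) := by
    intro i
    induction i with
    | zero => intro l _; rfl
    | succ i ih =>
      intro l hl
      rw [D.cf_succ (A l (by omega)) (k + l) i (hd (l + 1) (by omega))]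
      have := ih (l + 1) (by omega)
      have e : l + 1 + i = l + (i + 1) := by ring
      rw [e] at this
      exact this
  intro i hi'
  have := key i 0 (by omega)
  simp only [add_zero, zero_add] at this
  rw [this, cf]
  simp [OP]

end

lemma pp_pos {δ a : ℝ} (hδ : δ ≤ 0) (ha : 0 ≤ a) (l : ℕ) : 0 < pp δ a l := by
  refine prod_pos fun j _ => ?_
  have : 0 ≤ (a + j) * (-δ) := mul_nonneg (by positivity) (by linarith)
  linarith

lemma pp_succ' (δ a : ℝ) (l : ℕ) : pp δ a (l + 1) = (1 - a * δ) * pp δ (a + 1) l := by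
  unfold pp
  rw [prod_range_succ', mul_comm]
  simp only [Nat.cast_zero, add_zero]
  congr 1
  refine prod_congr rfl fun j _ => ?_
  push_cast; ring

lemma pp_one (δ a : ℝ) : pp δ a 1 = 1 - a * δ := by simp [pp]

lemma fall_succ' (x : ℝ) (l : ℕ) : fall (x + 1) (l + 1) = (x + 1) * fall x l := by
  unfold fall
  rw [prod_range_succ', mul_comm]
  simp only [Nat.cast_zero, sub_zero]
  congr 1
  refine prod_congr rfl fun j _ => ?_
  push_cast; ring

lemma fall_desc (N i : ℕ) (h : i ≤ N) : fall (N : ℝ) i = (N.descFactorial i : ℝ) := by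
  induction i with
  | zero => simp [fall]
  | succ i ih =>
    have h1 := ih (by omega)
    rw [Nat.descFactorial_succ, fall, prod_range_succ]
    rw [fall] at h1
    rw [h1]; push_cast [Nat.cast_sub (show i ≤ N by omega)]; ring

lemma choose_fall (N i : ℕ) (h : i < N) :
    (N.choose (i + 1) : ℝ) * (i + 1).factorial = fall (N : ℝ) i * (N - i) := by
  have h1 := fall_desc N (i + 1) h
  have h2 := Nat.descFactorial_eq_factorial_mul_choose N (i + 1)
  have h3 : fall (N : ℝ) (i + 1) = fall (N : ℝ) i * (N - i) := by
    rw [fall, prod_range_succ]; rfl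
  rw [← h3, h1, h2]; push_cast; ring

lemma fall_pos (N i : ℕ) (h : i ≤ N) : 0 < fall (N : ℝ) i := by
  rw [fall_desc N i h]
  exact_mod_cast Nat.descFactorial_pos.2 h

lemma Bq_one (δ : ℝ) (N : ℕ) : Bq δ 1 N = N.factorial * pp δ (N + 1) N := by
  have h : ((N.factorial : ℕ) : ℝ) = ∏ l ∈ range N, ((N - l : ℕ) : ℝ) := by
    have := Nat.descFactorial_eq_prod_range N N
    rw [Nat.descFactorial_self] at this
    rw [this]; push_cast; rfl
  rw [h, pp, Bq, ← prod_mul_distrib]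
  refine prod_congr rfl fun l hl => ?_
  have := mem_range.1 hl
  unfold lm
  push_cast [Nat.cast_sub this.le]
  ring

lemma term_alg {δ : ℝ} (hδ : δ ≤ 0) (N i : ℕ) (hi : i < N) (c W : ℝ) (hW : 0 < W) :
    c ^ 2 / (((i + 1).factorial : ℝ) * W * pp δ (((i + 1 : ℕ) : ℝ) - 1) (i + 1)) -
    ((N.choose (i + 1) : ℝ) * pp δ ((N : ℝ) + ((i + 1 : ℕ) : ℝ)) 1 /
          (fall ((N : ℝ) + 1) (i + 1) * W * pp δ (((i + 1 : ℕ) : ℝ) - 1) (i + 1) *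
            pp δ (N : ℝ) 1)) * c ^ 2 = 1 / ((N + 1) * (1 - N * δ)) * (c ^ 2 / (Bq δ 1 i * W)) := by
  have hN : (0:ℝ) < 1 - N * δ := by
    have : 0 ≤ (N:ℝ) * (-δ) := mul_nonneg (by positivity) (by linarith)
    linarith
  have hi0 : (0:ℝ) < 1 - i * δ := by
    have : 0 ≤ (i:ℝ) * (-δ) := mul_nonneg (by positivity) (by linarith)
    linarith
  have hP : 0 < pp δ ((i:ℝ) + 1) i := pp_pos hδ (by positivity) i
  have hF := fall_pos N i hi.le
  have hc := choose_fall N i hi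
  have hch : (N.choose (i + 1) : ℝ) = fall (N : ℝ) i * (N - i) / (((i:ℝ) + 1) * i.factorial) := by
    rw [eq_div_iff (by positivity), ← hc, Nat.factorial_succ]; push_cast; ring
  have e : (((i + 1 : ℕ) : ℝ) - 1) = i := by push_cast; ring
  rw [e, pp_one, pp_one, pp_succ', fall_succ', Bq_one, hch, Nat.factorial_succ]
  have hf : (0:ℝ) < i.factorial := by positivity
  push_cast
  obtain ⟨A, hA⟩ : ∃ A, A = 1 - (N:ℝ) * δ := ⟨_, rfl⟩
  obtain ⟨A', hA'⟩ : ∃ A', A' = 1 - (i:ℝ) * δ := ⟨_, rfl⟩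
  rw [← hA] at hN ⊢
  rw [← hA'] at hi0 ⊢
  field_simp
  rw [hA, hA']
  ring

lemma final_alg {δ : ℝ} (hδ : δ ≤ 0) (N : ℕ) (c W : ℕ → ℝ) (hW : ∀ i, 0 < W i) (E1 En : ℝ) :
    ((∑ i ∈ Finset.Icc 1 N, c i ^ 2 / ((i.factorial : ℝ) * W i * pp δ ((i : ℝ) - 1) i)) +
      En / (((N + 1).factorial : ℝ) * pp δ (((N + 1 : ℕ) : ℝ) - 1) (N + 1))) -
    ((∑ i ∈ Finset.Icc 1 N,
      ((N.choose i : ℝ) * pp δ ((N : ℝ) + i) 1 /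
          (fall ((N : ℝ) + 1) i * W i * pp δ ((i : ℝ) - 1) i * pp δ (N : ℝ) 1)) * c i ^ 2) +
      ((1 : ℝ) / (fall ((N : ℝ) + 1) 1 * pp δ (N : ℝ) 1)) * E1) =
    1 / ((N + 1) * (1 - N * δ) * Bq δ 1 N) *
      (En - Bq δ 1 N * (E1 - ∑ i ∈ range N, c (i + 1) ^ 2 / (Bq δ 1 i * W (i + 1)))) := by
  have hN : (0:ℝ) < 1 - N * δ := by
    have : 0 ≤ (N:ℝ) * (-δ) := mul_nonneg (by positivity) (by linarith)
    linarith
  have hB := Bq_pos hδ 1 N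
  have hs : (∑ i ∈ Finset.Icc 1 N, c i ^ 2 / ((i.factorial : ℝ) * W i * pp δ ((i : ℝ) - 1) i)) -
      (∑ i ∈ Finset.Icc 1 N,
      ((N.choose i : ℝ) * pp δ ((N : ℝ) + i) 1 /
          (fall ((N : ℝ) + 1) i * W i * pp δ ((i : ℝ) - 1) i * pp δ (N : ℝ) 1)) * c i ^ 2) =
      1 / ((N + 1) * (1 - N * δ)) * ∑ i ∈ range N, c (i + 1) ^ 2 / (Bq δ 1 i * W (i + 1)) := by
    rw [← sum_sub_distrib, mul_sum, range_eq_Ico, ← Finset.Ico_add_one_right_eq_Icc,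
      Finset.sum_Ico_eq_sum_range, ← range_eq_Ico]
    simp only [Nat.add_sub_cancel]
    refine sum_congr rfl fun i hi => ?_
    rw [add_comm 1 i]
    exact term_alg hδ N i (mem_range.1 hi) _ _ (hW _)
  have e1 : fall ((N : ℝ) + 1) 1 = N + 1 := by simp [fall]
  have e2 : ((N + 1).factorial : ℝ) * pp δ (((N + 1 : ℕ) : ℝ) - 1) (N + 1) =
      (N + 1) * (1 - N * δ) * Bq δ 1 N := by
    have e : (((N + 1 : ℕ) : ℝ) - 1) = N := by push_cast; ring
    rw [e, pp_succ', Bq_one, Nat.factorial_succ]; push_cast; ring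
  rw [e1, e2]
  set S := ∑ i ∈ range N, c (i + 1) ^ 2 / (Bq δ 1 i * W (i + 1))
  have h3 : ∀ a b x y : ℝ, (a + x) - (b + y) = (a - b) + (x - y) := fun a b x y => by ring
  rw [h3, hs, pp_one]
  obtain ⟨A, hA⟩ : ∃ A, A = 1 - (N:ℝ) * δ := ⟨_, rfl⟩
  rw [← hA] at hN ⊢
  field_simp
  ring

lemma eJ_open (α ω : EReal) : IsOpen (erealIoo α ω) := by
  have : erealIoo α ω = (Real.toEReal) ⁻¹' (Set.Ioo α ω) := rfl
  rw [this]; exact isOpen_Ioo.preimage continuous_coe_real_ereal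

lemma eJ_ord (α ω : EReal) : (erealIoo α ω).OrdConnected := by
  refine ⟨fun x hx y hy z hz => ⟨hx.1.trans_le ?_, lt_of_le_of_lt ?_ hy.2⟩⟩
  · exact_mod_cast hz.1
  · exact_mod_cast hz.2

lemma eJ_bdry (α ω : EReal) : ∃ S : Set ℝ, S.Countable ∧
    ∀ x ∉ erealIoo α ω, x ∉ S → ∀ᶠ y in nhds x, y ∉ erealIoo α ω := by
  refine ⟨{α.toReal, ω.toReal}, Set.to_countable _, fun x hx hS => ?_⟩
  have h1 : α ≠ (x : EReal) := by rintro rfl; simp at hS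
  have h2 : ω ≠ (x : EReal) := by rintro rfl; simp at hS
  have h3 : ¬ (α < (x : EReal) ∧ (x : EReal) < ω) := hx
  rw [not_and_or, not_lt, not_lt] at h3
  have hc := continuous_coe_real_ereal.continuousAt (x := x)
  rcases h3 with h3 | h3
  · have h4 : (x : EReal) < α := lt_of_le_of_ne h3 h1.symm
    filter_upwards [hc.eventually (gt_mem_nhds h4)] with y hy hyJ
    exact lt_irrefl _ (hy.trans hyJ.1)
  · have h4 : ω < (x : EReal) := lt_of_le_of_ne h3 h2
    filter_upwards [hc.eventually (lt_mem_nhds h4)] with y hy hyJ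
    exact lt_irrefl _ (hy.trans hyJ.2)

lemma aem_of_loc {J : Set ℝ} (Jo : IsOpen J) {h : ℝ → ℝ}
    (hl : ∀ x ∈ J, AEStronglyMeasurable h (volume.restrict (Set.Iic x ∩ J))) :
    AEStronglyMeasurable h (volume.restrict J) := by
  let ι := {r : ℚ // (r : ℝ) ∈ J}
  have e : J = ⋃ r : ι, (Set.Iic ((r.1 : ℚ) : ℝ) ∩ J) := by
    ext x
    simp only [Set.mem_iUnion, Set.mem_inter_iff, Set.mem_Iic]
    constructor
    · intro hx
      obtain ⟨ε, hε, hb⟩ := Metric.isOpen_iff.1 Jo x hx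
      obtain ⟨r, h1, h2⟩ := exists_rat_btwn (show x < x + ε by linarith)
      refine ⟨⟨r, hb ?_⟩, h1.le, hx⟩
      rw [Metric.mem_ball, Real.dist_eq, abs_lt]; constructor <;> linarith
    · rintro ⟨_, _, hx⟩; exact hx
  rw [e, aestronglyMeasurable_iUnion_iff]
  exact fun r => hl _ r.2

lemma pq_zero {δ β γ x ε : ℝ} (hε : 0 < ε) (h : ∀ y, x ≤ y → y < x + ε → pq δ β γ y = 0) :
    |δ| + |β| + |γ| = 0 := by
  have h0 := h x le_rfl (by linarith)
  have h1 := h (x + ε / 3) (by linarith) (by linarith)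
  have h2 := h (x + 2 * (ε / 3)) (by linarith) (by linarith)
  set e := ε / 3
  have he : 0 < e := by positivity
  unfold pq at h0 h1 h2
  have h3 : δ * (2 * e ^ 2) = 0 := by linear_combination h2 - 2 * h1 + h0
  have h4 : δ = 0 := (mul_eq_zero.1 h3).resolve_right (by positivity)
  subst h4
  have h5 : β * e = 0 := by linear_combination h1 - h0
  have h6 : β = 0 := (mul_eq_zero.1 h5).resolve_right he.ne'
  subst h6
  have h7 : γ = 0 := by linarith
  simp [h7]

section
variable {P : Measure ℝ} {f : ℝ → ℝ} {μ δ β γ : ℝ} {J : Set ℝ}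

lemma ip_aem (hIP : IsIntegratedPearson P f μ δ β γ) (Jo : IsOpen J) (hs : {x : ℝ | 0 < f x} = J) :
    AEMeasurable f volume := by
  obtain ⟨hP, f0, hPd, hid, hμ, hpos, hprim⟩ := hIP
  have fz : ∀ x ∉ J, f x = 0 := fun x hx => by
    rw [← hs] at hx; exact le_antisymm (not_lt.1 hx) (f0 x)
  have hIntOn : ∀ x ∈ J, IntegrableOn (fun t => (μ - t) * f t) (Set.Iic x) := by
    intro x hx
    by_contra hn
    obtain ⟨ε, hε, hb⟩ := Metric.isOpen_iff.1 Jo x hx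
    refine hpos.ne' (pq_zero (x := x) hε fun y hy hy2 => ?_)
    have hyJ : y ∈ J := hb (by rw [Metric.mem_ball, Real.dist_eq, abs_lt]; constructor <;> linarith)
    have h1 : ¬ IntegrableOn (fun t => (μ - t) * f t) (Set.Iic y) := fun h =>
      hn (h.mono_set (Set.Iic_subset_Iic.2 hy))
    have h2 := hprim y
    rw [integral_undef h1] at h2
    rw [← hs] at hyJ
    exact (mul_eq_zero.1 h2.symm).resolve_right (ne_of_gt hyJ)
  have h1 : AEStronglyMeasurable (fun t => (μ - t) * f t) (volume.restrict J) :=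
    aem_of_loc Jo fun x hx => (hIntOn x hx).aestronglyMeasurable.mono_set Set.inter_subset_left
  have h2 : AEStronglyMeasurable (fun t => (μ - t) * f t) volume := by
    rw [← aestronglyMeasurable_indicator_iff Jo.measurableSet] at h1
    have : J.indicator (fun t => (μ - t) * f t) = fun t => (μ - t) * f t := by
      ext t
      by_cases ht : t ∈ J
      · simp [ht]
      · simp [ht, fz t ht]
    rwa [this] at h1
  have h3 : AEMeasurable (fun t => (μ - t)⁻¹ * ((μ - t) * f t)) volume :=
    (measurable_const.sub measurable_id).inv.aemeasurable.mul h2.aemeasurable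
  refine h3.congr ?_
  have : ∀ᵐ x : ℝ, x ≠ μ := by simp [ae_iff, measure_singleton]
  filter_upwards [this] with x hx
  have : μ - x ≠ 0 := sub_ne_zero.2 hx.symm
  field_simp

lemma ip_conv (hIP : IsIntegratedPearson P f μ δ β γ) (hm : AEMeasurable f volume) (g : ℝ → ℝ) :
    (∫ x, g x ∂P = ∫ x, f x * g x) ∧ (Integrable g P ↔ Integrable (fun x => f x * g x)) := by
  obtain ⟨hP, f0, hPd, hid, hμ, hpos, hprim⟩ := hIP
  have e : ∀ x, (ENNReal.ofReal (f x)).toReal = f x := fun x => ENNReal.toReal_ofReal (f0 x)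
  rw [hPd]
  constructor
  · rw [integral_withDensity_eq_integral_toReal_smul₀ hm.ennreal_ofReal (by simp)]
    simp [e]
  · rw [integrable_withDensity_iff_integrable_smul₀' hm.ennreal_ofReal (by simp)]
    simp [e]

lemma moments (hm : Measurable f) (f0 : ∀ x, 0 ≤ f x) (hδ : δ ≤ 0) (i0 : Integrable f)
    (K : Ker f (fun x => pq δ β γ x * f x) 1 μ) (qn : ∀ x, 0 ≤ pq δ β γ x * f x) :
    ∀ j : ℕ, Integrable (fun x => f x * |x - μ| ^ j) ∧ Integrable (fun x => f x * |x - μ| ^ (j + 1)) := by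
  have mm : ∀ j : ℕ, AEStronglyMeasurable (fun x => f x * |x - μ| ^ j) volume := by
    intro j
    have : Measurable (fun x => f x * |x - μ| ^ j) := by fun_prop
    exact this.aestronglyMeasurable
  intro j
  induction j with
  | zero =>
    refine ⟨by simpa using i0, ?_⟩
    refine K.int1.norm.congr (Eventually.of_forall fun x => ?_)
    simp only [Real.norm_eq_abs, abs_mul, abs_of_nonneg (f0 x), abs_sub_comm μ x]; simp; ring
  | succ j ih =>
    obtain ⟨ia, ib⟩ := ih
    refine ⟨ib, mm _, ?_⟩
    set r : Polynomial ℝ := (Polynomial.X - Polynomial.C μ) ^ (j + 1) with hr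
    have hr0 : r.eval μ = 0 := by simp [hr]
    have hrx : ∀ x, |r.eval x| = |x - μ| ^ (j + 1) := by intro x; simp [hr, abs_pow]
    have hrd : ∀ x, |r.derivative.eval x| = (j + 1) * |x - μ| ^ j := by
      intro x
      have hj : |((j:ℝ) + 1)| = j + 1 := abs_of_nonneg (by positivity)
      simp [hr, Polynomial.derivative_pow, abs_mul, abs_pow, hj]
    have ht := K.tonelli (φ := fun t => ‖r.derivative.eval t‖ₑ)
      r.derivative.continuous.enorm.measurable.aemeasurable
    have hfin : ∫⁻ t, ENNReal.ofReal (pq δ β γ t * f t) * ‖r.derivative.eval t‖ₑ < ⊤ := by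
      have hI : Integrable (fun t => (j + 1 : ℝ) * |pq δ β γ μ| * (f t * |t - μ| ^ j) +
          (j + 1 : ℝ) * |2 * δ * μ + β| * (f t * |t - μ| ^ (j + 1))) :=
        (ia.const_mul _).add (ib.const_mul _)
      refine lt_of_le_of_lt (lintegral_mono fun t => ?_) hI.2
      rw [Real.enorm_eq_ofReal_abs, ← ENNReal.ofReal_mul (qn t), hrd, Real.enorm_eq_ofReal_abs]
      refine ENNReal.ofReal_le_ofReal (le_trans ?_ (le_abs_self _))
      have hq : pq δ β γ t ≤ |pq δ β γ μ| + |2 * δ * μ + β| * |t - μ| := by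
        have e1 : pq δ β γ t = pq δ β γ μ + (2 * δ * μ + β) * (t - μ) + δ * (t - μ) ^ 2 := by
          unfold pq; ring
        have e2 : (2 * δ * μ + β) * (t - μ) ≤ |2 * δ * μ + β| * |t - μ| := by
          rw [← abs_mul]; exact le_abs_self _
        have e3 : δ * (t - μ) ^ 2 ≤ 0 := mul_nonpos_of_nonpos_of_nonneg hδ (sq_nonneg _)
        have := le_abs_self (pq δ β γ μ)
        linarith
      have h1 : 0 ≤ f t * ((j + 1 : ℝ) * |t - μ| ^ j) := mul_nonneg (f0 t) (by positivity)
      have h2 := mul_le_mul_of_nonneg_right hq h1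
      calc _ = pq δ β γ t * (f t * ((j + 1 : ℝ) * |t - μ| ^ j)) := by ring
        _ ≤ _ := h2
        _ = _ := by ring
    rw [hasFiniteIntegral_iff_ofReal (Eventually.of_forall fun x =>
      mul_nonneg (f0 x) (by positivity))]
    rw [ht] at hfin
    refine lt_of_le_of_lt (lintegral_mono fun x => ?_) hfin
    have h3 := (AC.poly Set.univ r).enorm_le (c := μ) (x := x) trivial trivial
    rw [hr0, sub_zero, Real.enorm_eq_ofReal_abs, hrx] at h3
    calc ENNReal.ofReal (f x * |x - μ| ^ (j + 1 + 1))
        = ENNReal.ofReal (1 * |x - μ| * f x) * ENNReal.ofReal (|x - μ| ^ (j + 1)) := by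
          rw [← ENNReal.ofReal_mul (by have := f0 x; positivity)]; congr 1; ring
      _ ≤ _ := by gcongr

lemma mk_PD (hδ : δ ≤ 0) (hIP : IsIntegratedPearson P f μ δ β γ) (α ω : EReal)
    (hs : {x : ℝ | 0 < f x} = erealIoo α ω) : PD f μ δ β γ (erealIoo α ω) := by
  have Jo := eJ_open α ω
  have hb := eJ_bdry α ω
  have Jc := eJ_ord α ω
  set J := erealIoo α ω
  have ham := ip_aem hIP Jo hs
  have conv := ip_conv hIP ham
  obtain ⟨hP, f0, hPd, hid, hμ, hpos, hprim⟩ := hIP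
  have fp : ∀ x ∈ J, 0 < f x := fun x hx => by rw [← hs] at hx; exact hx
  have fz : ∀ x ∉ J, f x = 0 := fun x hx => by
    rw [← hs] at hx; exact le_antisymm (not_lt.1 hx) (f0 x)
  have i0 : Integrable f := by
    have := (conv fun _ => 1).2.1 (integrable_const _)
    simpa using this
  have t0 : ∫ x, f x = 1 := by
    have := (conv fun _ => 1).1
    simpa using this.symm
  have i1 : Integrable (fun x => f x * x) := (conv fun x => x).2.1 hid
  have t1 : ∫ x, f x * x = μ := by rw [hμ]; exact (conv fun x => x).1.symm
  have Jne : J.Nonempty := by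
    by_contra h
    rw [Set.not_nonempty_iff_eq_empty] at h
    have : f = 0 := by ext x; exact fz x (by simp [h])
    rw [this] at t0; simp at t0
  have im : Integrable (fun t => (μ - t) * f t) := by
    refine ((i0.const_mul μ).sub i1).congr (Eventually.of_forall fun x => ?_)
    simp; ring
  have tm : ∫ t, (μ - t) * f t = 0 := by
    have : ∫ t, (μ - t) * f t = ∫ t, (μ * f t - f t * t) := by congr 1; ext t; ring
    rw [this, integral_sub (i0.const_mul μ) i1, integral_const_mul, t0, t1]; ring
  have qf : ∀ x ∈ J, 0 < pq δ β γ x * f x := by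
    intro x hx
    obtain ⟨ε, hε, hball⟩ := Metric.isOpen_iff.1 Jo x hx
    have hsub : ∀ y, |y - x| < ε → y ∈ J := fun y hy => hball (by rwa [Metric.mem_ball, Real.dist_eq])
    rw [← hprim]
    rcases le_or_gt x μ with hxm | hxm
    · rw [setIntegral_pos_iff_support_of_nonneg_ae ?_ im.integrableOn]
      · refine lt_of_lt_of_le ?_ (measure_mono (s := Set.Ioo (x - ε) x) ?_)
        · simp [hε]
        · rintro y ⟨h1, h2⟩
          refine ⟨mul_ne_zero (by linarith) (fp y (hsub y ?_)).ne', h2.le⟩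
          rw [abs_lt]; constructor <;> linarith
      · rw [EventuallyLE, ae_restrict_iff' measurableSet_Iic]
        refine Eventually.of_forall fun t ht => mul_nonneg ?_ (f0 t)
        have : t ≤ x := ht
        linarith
    · have h4 := intervalIntegral.integral_Iic_add_Ioi (b := x) im.integrableOn im.integrableOn
      rw [tm] at h4
      have h5 : 0 < ∫ t in Set.Ioi x, -((μ - t) * f t) := by
        have imn : Integrable (fun t => -((μ - t) * f t)) := im.neg
        rw [setIntegral_pos_iff_support_of_nonneg_ae ?_ imn.integrableOn]
        · refine lt_of_lt_of_le ?_ (measure_mono (s := Set.Ioo x (x + ε)) ?_)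
          · simp [hε]
          · rintro y ⟨h1, h2⟩
            refine ⟨neg_ne_zero.2 (mul_ne_zero (by linarith) (fp y (hsub y ?_)).ne'), h1⟩
            rw [abs_lt]; constructor <;> linarith
        · rw [EventuallyLE, ae_restrict_iff' measurableSet_Ioi]
          refine Eventually.of_forall fun t ht => ?_
          have : x < t := ht
          have h6 : 0 ≤ (t - μ) * f t := mul_nonneg (by linarith) (f0 t)
          simp only [Pi.zero_apply]; linarith
      rw [integral_neg] at h5
      linarith
  have qpos : ∀ x ∈ J, 0 < pq δ β γ x := fun x hx => (pos_iff_pos_of_mul_pos (qf x hx)).2 (fp x hx)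
  have Fc : Continuous (fun x => pq δ β γ x * f x) := by
    have e : (fun x => pq δ β γ x * f x) =
        fun x => pq δ β γ 0 * f 0 + ∫ t in (0:ℝ)..x, (μ - t) * f t := by
      ext x
      rw [← hprim, ← hprim,
        ← intervalIntegral.integral_Iic_sub_Iic im.integrableOn im.integrableOn]
      ring
    rw [e]
    exact continuous_const.add (intervalIntegral.continuous_primitive
        (fun a b => im.intervalIntegrable) 0)
  have fc : ContinuousOn f J := by
    have h1 : ContinuousOn (fun x => pq δ β γ x * f x / pq δ β γ x) J :=
      Fc.continuousOn.div (pq_cont δ β γ).continuousOn (fun x hx => (qpos x hx).ne')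
    refine h1.congr fun x hx => ?_
    have := (qpos x hx).ne'
    simp only; field_simp
  have fm : Measurable f := by
    classical
    have h1 := fc.measurable_piecewise (g := fun _ => (0:ℝ)) continuousOn_const Jo.measurableSet
    have h2 : J.piecewise f (fun _ => 0) = f := by
      ext x
      by_cases hx : x ∈ J
      · simp [hx]
      · simp [hx, fz x hx]
    rwa [h2] at h1
  have K : Ker f (fun x => pq δ β γ x * f x) 1 μ :=
    { lam_pos := one_pos, v_meas := fm, v_nonneg := f0, int1 := by simpa using im
      prim := fun x => by simpa using hprim x
      total := by simpa using tm }
  have qn : ∀ x, 0 ≤ pq δ β γ x * f x := fun x => by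
    by_cases hx : x ∈ J
    · exact (qf x hx).le
    · simp [fz x hx]
  have mom := moments fm f0 hδ i0 K qn
  refine { hδ := hδ, fmeas := fm, fpos := fp, f0 := fz, Jopen := Jo, Jord := Jc, Jne := Jne,
           bdry := hb, qpos := qpos, fcont := fc, mom := ?_, prim := hprim }
  intro r
  have e : ∀ x, f x * r.eval x = ∑ i ∈ range ((Polynomial.taylor μ r).natDegree + 1),
      (Polynomial.taylor μ r).coeff i * (f x * (x - μ) ^ i) := by
    intro x
    have h1 := Polynomial.taylor_eval μ r (x - μ)
    rw [sub_add_cancel] at h1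
    rw [← h1, Polynomial.eval_eq_sum_range, mul_sum]
    exact sum_congr rfl fun i _ => by ring
  simp_rw [e]
  refine integrable_finsetSum _ fun i _ => Integrable.const_mul ?_ _
  have h2 : Measurable (fun x => f x * (x - μ) ^ i) := by fun_prop
  refine (mom i).1.mono' h2.aestronglyMeasurable (Eventually.of_forall fun x => ?_)
  rw [Real.norm_eq_abs, abs_mul, abs_pow, abs_of_nonneg (f0 x)]
end

lemma rat_sandwich {J : Set ℝ} (Jo : IsOpen J) {x : ℝ} (hx : x ∈ J) :
    ∃ a b : ℚ, (a : ℝ) ∈ J ∧ (b : ℝ) ∈ J ∧ (a : ℝ) < x ∧ x < b := by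
  obtain ⟨ε, hε, hball⟩ := Metric.isOpen_iff.1 Jo x hx
  obtain ⟨a, ha1, ha2⟩ := exists_rat_btwn (show x - ε < x by linarith)
  obtain ⟨b, hb1, hb2⟩ := exists_rat_btwn (show x < x + ε by linarith)
  refine ⟨a, b, hball ?_, hball ?_, ha2, hb1⟩
  · rw [Metric.mem_ball, Real.dist_eq, abs_lt]; constructor <;> linarith
  · rw [Metric.mem_ball, Real.dist_eq, abs_lt]; constructor <;> linarith

lemma ae_of_loc {J : Set ℝ} (Jo : IsOpen J) {p : ℝ → Prop}
    (h : ∀ a ∈ J, ∀ b ∈ J, ∀ᵐ x, x ∈ Set.uIcc a b → p x) : ∀ᵐ x, x ∈ J → p x := by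
  have h' : ∀ a b : ℚ, ∀ᵐ x : ℝ, (a : ℝ) ∈ J → (b : ℝ) ∈ J → x ∈ Set.uIcc (a : ℝ) b → p x := by
    intro a b
    by_cases ha : (a : ℝ) ∈ J
    · by_cases hb : (b : ℝ) ∈ J
      · filter_upwards [h a ha b hb] with x hx _ _ using hx
      · exact Eventually.of_forall fun x _ h => absurd h hb
    · exact Eventually.of_forall fun x h => absurd h ha
  have h2 := ae_all_iff.2 fun a => ae_all_iff.2 (h' a)
  filter_upwards [h2] with x hx hxJ
  obtain ⟨a, b, ha, hb, h1, h3⟩ := rat_sandwich Jo hxJ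
  refine hx a b ha hb ?_
  rw [Set.uIcc_of_le (h1.trans h3).le]
  exact ⟨h1.le, h3.le⟩

lemma aem_of_ii {J : Set ℝ} (Jo : IsOpen J) (Jc : J.OrdConnected) {h : ℝ → ℝ}
    (hl : ∀ a ∈ J, ∀ b ∈ J, IntervalIntegrable h volume a b) :
    AEStronglyMeasurable h (volume.restrict J) := by
  let ι := {r : ℚ × ℚ // (r.1 : ℝ) ∈ J ∧ (r.2 : ℝ) ∈ J}
  have e : J = ⋃ r : ι, Set.Ioc (r.1.1 : ℝ) (r.1.2 : ℝ) := by
    ext x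
    simp only [Set.mem_iUnion]
    constructor
    · intro hx
      obtain ⟨a, b, ha, hb, h1, h3⟩ := rat_sandwich Jo hx
      exact ⟨⟨(a, b), ha, hb⟩, h1, h3.le⟩
    · rintro ⟨⟨⟨a, b⟩, ha, hb⟩, h1, h3⟩
      exact Jc.out ha hb ⟨h1.le, h3⟩
  rw [e, aestronglyMeasurable_iUnion_iff]
  rintro ⟨⟨a, b⟩, ha, hb⟩
  exact (hl a ha b hb).1.aestronglyMeasurable

lemma AC.ofInd {J : Set ℝ} (Jo : IsOpen J) (Jc : J.OrdConnected) {h h' : ℝ → ℝ}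
    (hc : ContinuousOn h J) (hi : ∀ a ∈ J, ∀ b ∈ J, IntervalIntegrable h' volume a b ∧
      h b - h a = ∫ t in a..b, h' t) : AC J (J.indicator h) (J.indicator h') := by
  have hsub : ∀ a ∈ J, ∀ b ∈ J, Set.uIcc a b ⊆ J := fun a ha b hb => Jc.uIcc_subset ha hb
  refine ⟨hc.congr fun x hx => Set.indicator_of_mem hx _, ?_, ?_, ?_, ?_⟩
  · exact (aestronglyMeasurable_indicator_iff Jo.measurableSet).2
      (hc.aestronglyMeasurable Jo.measurableSet)
  · exact (aestronglyMeasurable_indicator_iff Jo.measurableSet).2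
      (aem_of_ii Jo Jc fun a ha b hb => (hi a ha b hb).1)
  · intro a ha b hb
    refine (hi a ha b hb).1.congr fun x hx => ?_
    exact (Set.indicator_of_mem (hsub a ha b hb (Set.uIoc_subset_uIcc hx)) _).symm
  · intro a ha b hb
    rw [Set.indicator_of_mem ha, Set.indicator_of_mem hb, (hi a ha b hb).2]
    refine intervalIntegral.integral_congr fun x hx => ?_
    exact (Set.indicator_of_mem (hsub a ha b hb hx) _).symm

lemma poly_antideriv (q : Polynomial ℝ) (d : ℕ) (hq : q.natDegree ≤ d) :
    ∃ p : Polynomial ℝ, p.natDegree ≤ d + 1 ∧ p.derivative = q := by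
  refine ⟨∑ i ∈ range (d + 1), Polynomial.C (q.coeff i / (i + 1)) * Polynomial.X ^ (i + 1), ?_, ?_⟩
  · refine Polynomial.natDegree_sum_le_of_forall_le _ _ fun i hi => ?_
    refine (Polynomial.natDegree_C_mul_X_pow_le _ _).trans ?_
    have := mem_range.1 hi
    omega
  · rw [Polynomial.derivative_sum]
    conv_rhs => rw [q.as_sum_range' (d + 1) (by omega)]
    refine sum_congr rfl fun i _ => ?_
    rw [Polynomial.derivative_C_mul_X_pow, ← Polynomial.C_mul_X_pow_eq_monomial]
    have h : ((i:ℝ) + 1) ≠ 0 := by positivity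
    simp only [Nat.add_sub_cancel]
    congr 2
    push_cast
    field_simp

lemma poly_integrate {J : Set ℝ} (Jo : IsOpen J) (Jc : J.OrdConnected) {h h' : ℝ → ℝ} (d : ℕ)
    (hd : ∀ x ∈ J, HasDerivAt h (h' x) x) (hp : IsPolyOn h' J d) : IsPolyOn h J (d + 1) := by
  obtain ⟨q, hq, hqe⟩ := hp
  obtain ⟨p, hp, rfl⟩ := poly_antideriv q d hq
  rcases J.eq_empty_or_nonempty with rfl | ⟨c, hc⟩
  · exact ⟨p, hp, by simp⟩
  refine ⟨p + Polynomial.C (h c - p.eval c), ?_, fun x hx => ?_⟩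
  · rw [Polynomial.natDegree_add_C]; exact hp
  · have hsub := Jc.uIcc_subset hc hx
    have h1 := intervalIntegral.integral_eq_sub_of_hasDerivAt (a := c) (b := x)
      (f := fun y => h y - p.eval y) (f' := fun _ => 0) (fun y hy => by
        have := (hd y (hsub hy)).sub (p.hasDerivAt y)
        rwa [hqe y (hsub hy), sub_self] at this) (by simp)
    simp at h1
    simp
    linarith

lemma poly_back {J : Set ℝ} (Jo : IsOpen J) (Jc : J.OrdConnected) (gd : ℕ → ℝ → ℝ) (M : ℕ) :
    ∀ d, (∀ k < M, ∀ x ∈ J, HasDerivAt (gd k) (gd (k + 1) x) x) → IsPolyOn (gd M) J d →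
    IsPolyOn (gd 0) J (d + M) := by
  induction M with
  | zero => intro d _ h; simpa using h
  | succ M ih =>
    intro d hd h
    have := ih (d + 1) (fun k hk => hd k (by omega)) (poly_integrate Jo Jc d (hd M (by omega)) h)
    rwa [show d + (M + 1) = d + 1 + M by omega]

lemma poly_fwd {J : Set ℝ} (Jo : IsOpen J) (gd : ℕ → ℝ → ℝ) (p : Polynomial ℝ) (M : ℕ)
    (hd : ∀ k < M, ∀ x ∈ J, HasDerivAt (gd k) (gd (k + 1) x) x)
    (h0 : ∀ x ∈ J, gd 0 x = p.eval x) :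
    ∀ k ≤ M, ∀ x ∈ J, gd k x = (Polynomial.derivative^[k] p).eval x := by
  intro k
  induction k with
  | zero => intro _; simpa using h0
  | succ k ih =>
    intro hk x hx
    have h1 := hd k (by omega) x hx
    have h2 : HasDerivAt (gd k) ((Polynomial.derivative^[k] p).derivative.eval x) x :=
      ((Polynomial.derivative^[k] p).hasDerivAt x).congr_of_eventuallyEq
        (by filter_upwards [Jo.mem_nhds hx] with y hy using ih (by omega) y hy)
    rw [Function.iterate_succ_apply']
    exact h1.unique h2

lemma poly_last {J : Set ℝ} (Jo : IsOpen J) (Jc : J.OrdConnected) {h h' : ℝ → ℝ} (p : Polynomial ℝ)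
    (hi : ∀ a ∈ J, ∀ b ∈ J, IntervalIntegrable h' volume a b ∧
      h b - h a = ∫ t in a..b, h' t) (hp : ∀ x ∈ J, h x = p.eval x) :
    ∀ᵐ x, x ∈ J → h' x = p.derivative.eval x := by
  refine ae_of_loc Jo fun a ha b hb => ?_
  have hsub := Jc.uIcc_subset ha hb
  filter_upwards [(hi a ha b hb).1.ae_hasDerivAt_integral] with x hx hxm
  have h1 := hx hxm a Set.left_mem_uIcc
  have h2 : HasDerivAt (fun y => ∫ t in a..y, h' t) (p.derivative.eval x) x := by
    refine ((p.hasDerivAt x).sub_const (p.eval a)).congr_of_eventuallyEq ?_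
    filter_upwards [Jo.mem_nhds (hsub hxm)] with y hy
    rw [← (hi a ha y hy).2, hp y hy, hp a ha]
  exact h1.unique h2

/-- **Theorem 3.2(b).** If `X ∼ IP(μ; δ, β, γ)` with `δ ≤ 0`, `n ≥ 1` and
`g ∈ H^{n,n}(X)`, then `S_{n−1,1}(g) ≤ S_{n,(weak)}`, with equality iff `n = 1`
or `g` coincides on the support of `X` with a polynomial of degree at most `n`. -/
theorem pearson_Snm1_le_Sweak
    (P : Measure ℝ) (f : ℝ → ℝ) (μ δ β γ : ℝ) (hδ : δ ≤ 0)
    (hIP : IsIntegratedPearson P f μ δ β γ)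
    (α ω : EReal) (hsupp : {x : ℝ | 0 < f x} = erealIoo α ω)
    (n : ℕ) (hn : 1 ≤ n) (gd : ℕ → ℝ → ℝ)
    (hg : MemH P (pq δ β γ) (erealIoo α ω) n n gd) :
    Sbound P δ (pq δ β γ) (n - 1) 1 gd ≤ SweakBound P δ (pq δ β γ) n gd ∧
    (Sbound P δ (pq δ β γ) (n - 1) 1 gd = SweakBound P δ (pq δ β γ) n gd ↔
      n = 1 ∨ IsPolyOn (gd 0) (erealIoo α ω) n) := by
  obtain ⟨N, rfl⟩ : ∃ N, n = N + 1 := ⟨n - 1, by omega⟩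
  have D := mk_PD hδ hIP α ω hsupp
  set J := erealIoo α ω with hJ
  have Jo := D.Jopen
  have Jc := D.Jord
  obtain ⟨g1, g2, g3, g4, -⟩ := hg
  simp only [max_self, Nat.add_sub_cancel, Nat.succ_le_iff, Nat.succ_pos, forall_true_left] at g1 g2 g3
  set ψ : ℕ → ℝ → ℝ := fun l => J.indicator (gd (l + 1)) with hψ
  have hcont : ∀ k ≤ N, ContinuousOn (gd k) J := by
    intro k hk
    rcases hk.eq_or_lt with rfl | hk
    · exact g2
    · exact fun x hx => (g1 k (by omega) x hx).continuousAt.continuousWithinAt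
  have hstep : ∀ k ≤ N, ∀ a ∈ J, ∀ b ∈ J, IntervalIntegrable (gd (k + 1)) volume a b ∧
      gd k b - gd k a = ∫ t in a..b, gd (k + 1) t := by
    intro k hk a ha b hb
    rcases hk.eq_or_lt with rfl | hk
    · exact g3 a ha b hb
    · have hsub := Jc.uIcc_subset ha hb
      have hii : IntervalIntegrable (gd (k + 1)) volume a b :=
        ((hcont (k + 1) hk).mono hsub).intervalIntegrable
      exact ⟨hii, (intervalIntegral.integral_eq_sub_of_hasDerivAt
        (fun x hx => g1 k (by omega) x (hsub hx)) hii).symm⟩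
  have A : ∀ l < N, AC J (ψ l) (ψ (l + 1)) := fun l hl =>
    AC.ofInd Jo Jc (hcont (l + 1) hl) (hstep (l + 1) hl)
  have conv := fun g => ip_conv hIP D.fmeas.aemeasurable g
  have eW : ∀ i, ∫ x, pq δ β γ x ^ i ∂P = ∫ x, ww f δ β γ i x := fun i => (conv _).1
  have eC : ∀ i, ∫ x, pq δ β γ x ^ i * gd i x ∂P = ∫ x, ww f δ β γ i x * gd i x := fun i => by
    rw [(conv _).1]; simp only [ww, mul_assoc]
  have eS : ∀ i, ∫ x, pq δ β γ x ^ i * gd i x ^ 2 ∂P = ∫ x, ww f δ β γ i x * gd i x ^ 2 := fun i => by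
    rw [(conv _).1]; simp only [ww, mul_assoc]
  have eψ : ∀ i, ∀ x ∈ J, ψ i x = gd (i + 1) x := fun i x hx => Set.indicator_of_mem hx _
  have hi : Integrable (fun x => ww f δ β γ (1 + N) x * ψ N x ^ 2) := by
    refine (((conv _).2).1 g4).congr (Eventually.of_forall fun x => ?_)
    by_cases hx : x ∈ J
    · simp only [eψ N x hx, ww, mul_assoc, add_comm 1 N]
    · simp [ww, D.f0 x hx]
  have cC : ∀ i, ∫ x, ww f δ β γ (i + 1) x * ψ i x = ∫ x, ww f δ β γ (i + 1) x * gd (i + 1) x :=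
    fun i => D.int_congr _ (Eventually.of_forall (eψ i))
  have cS : ∀ i, ∫ x, ww f δ β γ (i + 1) x * ψ i x ^ 2 = ∫ x, ww f δ β γ (i + 1) x * gd (i + 1) x ^ 2 :=
    fun i => D.int_congr (a := fun x => ψ i x ^ 2) (b := fun x => gd (i + 1) x ^ 2) _
      (Eventually.of_forall fun x hx => by rw [eψ i x hx])
  have hcf := D.cf_iter 1 ψ N A hi
  have hRR : RR f μ δ β γ N 1 (ψ 0) = (∫ x, ww f δ β γ 1 x * gd 1 x ^ 2) -
      ∑ i ∈ range N, (∫ x, ww f δ β γ (i + 1) x * gd (i + 1) x) ^ 2 /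
        (Bq δ 1 i * ∫ x, ww f δ β γ (i + 1) x) := by
    rw [RR]
    congr 1
    · exact cS 0
    · refine sum_congr rfl fun i hi => ?_
      rw [hcf i (mem_range.1 hi).le, MM_eq, add_comm 1 i, cC]
  have hEn : ∫ x, ww f δ β γ (1 + N) x * ψ N x ^ 2 =
      ∫ x, ww f δ β γ (N + 1) x * gd (N + 1) x ^ 2 := by
    rw [add_comm 1 N]; exact cS N
  have hle := D.core_le 1 ψ N A hi
  have key : SweakBound P δ (pq δ β γ) (N + 1) gd - Sbound P δ (pq δ β γ) N 1 gd =
      1 / ((N + 1) * (1 - N * δ) * Bq δ 1 N) * ((∫ x, ww f δ β γ (1 + N) x * ψ N x ^ 2) -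
        Bq δ 1 N * RR f μ δ β γ N 1 (ψ 0)) := by
    rw [hRR, hEn]
    rw [← final_alg hδ N (fun i => ∫ x, ww f δ β γ i x * gd i x) (fun i => ∫ x, ww f δ β γ i x)
      (fun i => D.W_pos i)]
    rw [SweakBound, Sbound]
    simp only [eW, eC, eS, Nat.add_sub_cancel]
    simp
  have hpos : 0 < 1 / (((N:ℝ) + 1) * (1 - N * δ) * Bq δ 1 N) := by
    have h1 := Bq_pos hδ 1 N
    have h2 : 0 < 1 - N * δ := by
      have : (N:ℝ) * δ ≤ 0 := mul_nonpos_of_nonneg_of_nonpos (by positivity) hδ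
      linarith
    positivity
  have hEq : Sbound P δ (pq δ β γ) N 1 gd = SweakBound P δ (pq δ β γ) (N + 1) gd ↔
      (∫ x, ww f δ β γ (1 + N) x * ψ N x ^ 2) ≤ Bq δ 1 N * RR f μ δ β γ N 1 (ψ 0) := by
    constructor
    · intro h
      rw [h, sub_self] at key
      rcases mul_eq_zero.1 key.symm with h | h
      · exact absurd h hpos.ne'
      · linarith
    · intro h
      rw [le_antisymm h hle, sub_self, mul_zero] at key
      linarith
  rw [Nat.add_sub_cancel]
  refine ⟨?_, ?_⟩
  · have := mul_nonneg hpos.le (sub_nonneg.2 hle)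
    rw [← key] at this
    linarith
  rw [hEq]
  constructor
  · intro h
    rcases N with _ | M
    · left; rfl
    right
    obtain ⟨a, b, hab⟩ := D.core_eq 1 ψ M A hi h
    have hp : IsPolyOn (gd (M + 1)) J 1 := by
      refine ⟨Polynomial.C a * Polynomial.X + Polynomial.C b, Polynomial.natDegree_linear_le, ?_⟩
      intro x hx
      rw [← eψ M x hx, hab x hx]; simp
    have := poly_back Jo Jc gd (M + 1) 1 (fun k hk => g1 k (by omega)) hp
    rwa [show M + 1 + 1 = 1 + (M + 1) by omega]
  · intro h
    rcases N with _ | M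
    · simp [RR_zero, Bq]
    rcases h with h | ⟨p, hp, hpe⟩
    · omega
    have hf := poly_fwd Jo gd p (M + 1) (fun k hk => g1 k (by omega)) hpe
    have hl := poly_last Jo Jc (Polynomial.derivative^[M + 1] p) g3 (hf (M + 1) le_rfl)
    refine D.core_poly 1 ψ (M + 1) p.derivative ?_ ?_ ?_
    · exact (Polynomial.natDegree_derivative_le p).trans (by omega)
    · refine Eventually.of_forall fun x hx => ?_
      rw [eψ 0 x hx, hf 1 (by omega) x hx]; simp
    · filter_upwards [hl] with x hx hxJ
      rw [eψ _ x hxJ, hx hxJ, ← Function.iterate_succ_apply' (Polynomial.derivative), Function.iterate_succ_apply]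

end
end

section
/- Let m, n, k be nonnegative integers and let δ ≤ 0 be a real number. Then Σ_{i=0}^{n} (−1)^i C(n,i) · ((k)_i/(m+n)_i) · (∏_{j=k−1}^{k+i−2}(1−jδ) / ∏_{j=m}^{m+i−1}(1−jδ)) = (m+n−k)_n ∏_{j=m+k}^{m+n+k−1}(1−jδ) / [(m+n)_n ∏_{j=m}^{m+n−1}(1−jδ)]. -/
open MeasureTheory ProbabilityTheory Finset Filter

noncomputable section

lemma aux_pp_add (δ a : ℝ) (i r : ℕ) : pp δ a (i + r) = pp δ a i * pp δ (a + i) r := by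
  unfold pp
  rw [Finset.prod_range_add]
  congr 1
  refine Finset.prod_congr rfl fun j _ => ?_
  push_cast; ring

lemma aux_pp_succ (δ a : ℝ) (r : ℕ) : pp δ a (r + 1) = pp δ a r * (1 - (a + r) * δ) := by
  unfold pp
  rw [Finset.prod_range_succ]

lemma aux_pp_succ' (δ a : ℝ) (r : ℕ) : pp δ a (r + 1) = (1 - a * δ) * pp δ (a + 1) r := by
  rw [add_comm r 1, aux_pp_add]
  simp [pp]

lemma aux_rise_succ (a : ℝ) (r : ℕ) : rise a (r + 1) = rise a r * (a + r) := by
  unfold rise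
  rw [Finset.prod_range_succ]

lemma aux_fall_rise (m : ℝ) (r : ℕ) : fall (m + r) r = rise (m + 1) r := by
  unfold fall rise
  rw [← Finset.prod_range_reflect]
  refine Finset.prod_congr rfl fun j hj => ?_
  have hj' := Finset.mem_range.1 hj
  have : r - 1 - j + (1 + j) = r := by omega
  have h2 : ((r - 1 - j : ℕ) : ℝ) + (1 + j) = r := by exact_mod_cast this
  linarith

lemma aux_fall_add (x : ℝ) (i r : ℕ) : fall x (i + r) = fall x i * fall (x - i) r := by
  unfold fall
  rw [Finset.prod_range_add]
  congr 1
  refine Finset.prod_congr rfl fun j _ => ?_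
  push_cast; ring

/-- Newton coefficients. -/
def auxB (m δ : ℝ) (i n : ℕ) : ℝ :=
  (-1) ^ i * (n.choose i : ℝ) * (rise (m + 1) (n - i) * pp δ (m + i) (n - i))

/-- the quadratic node function -/
def auxf (δ t : ℝ) : ℝ := t * (1 - (t - 1) * δ)

lemma auxB_zero (m δ : ℝ) (n : ℕ) :
    auxB m δ 0 (n + 1) = auxB m δ 0 n * (auxf δ (m + n + 1) - auxf δ 0) := by
  simp only [auxB, auxf, Nat.sub_zero, aux_pp_succ, aux_rise_succ, Nat.choose_zero_right]
  push_cast; ring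

lemma auxB_succ (m δ : ℝ) (n i : ℕ) (hi : i ≤ n) :
    auxB m δ (i + 1) (n + 1) =
      auxB m δ (i + 1) n * (auxf δ (m + n + 1) - auxf δ ((i + 1 : ℕ) : ℝ)) - auxB m δ i n := by
  rcases hi.eq_or_lt with rfl | hlt
  · simp [auxB, pp, rise, pow_succ]
  · obtain ⟨r, rfl⟩ : ∃ r, n = i + 1 + r := ⟨n - (i + 1), by omega⟩
    have e1 : i + 1 + r + 1 - (i + 1) = r + 1 := by omega
    have e2 : i + 1 + r - (i + 1) = r := by omega
    have e3 : i + 1 + r - i = r + 1 := by omega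
    have hc := Nat.choose_succ_right_eq (i + 1 + r) i
    rw [e3] at hc
    have hc' : ((i + 1 + r).choose (i + 1) : ℝ) * (i + 1) = ((i + 1 + r).choose i : ℝ) * (r + 1) := by
      exact_mod_cast hc
    simp only [auxB, auxf, e1, e2, e3, Nat.choose_succ_succ' (i + 1 + r) i]
    rw [aux_pp_succ' δ (m + i), aux_pp_succ δ, aux_rise_succ]
    push_cast
    rw [← add_assoc m (i : ℝ) 1, pow_succ]
    generalize ((i + 1 + r).choose (i + 1) : ℝ) = c1 at *
    generalize ((i + 1 + r).choose i : ℝ) = c0 at *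
    generalize rise (m + 1) r = R
    generalize pp δ (m + i + 1) r = Q
    generalize (-1 : ℝ) ^ i = s
    linear_combination (-(s * R * Q * (m + 1 + r) * δ)) * hc'

lemma aux_main (m k δ : ℝ) (n : ℕ) :
    ∑ i ∈ Finset.range (n + 1), auxB m δ i n * (fall k i * pp δ (k - 1) i) =
      ∏ j ∈ Finset.range n, (auxf δ (m + j + 1) - auxf δ k) := by
  induction n with
  | zero => simp [auxB, pp, rise, fall]
  | succ n ih =>
    rw [Finset.prod_range_succ, ← ih]
    set A : ℕ → ℝ := fun i => fall k i * pp δ (k - 1) i with hA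
    have hAs : ∀ i, A (i + 1) = A i * (auxf δ k - auxf δ (i : ℝ)) := by
      intro i
      simp only [hA, aux_pp_succ, auxf]
      have : fall k (i + 1) = fall k i * (k - i) := by
        unfold fall; rw [Finset.prod_range_succ]
      rw [this]; ring
    change ∑ i ∈ Finset.range (n + 1 + 1), auxB m δ i (n + 1) * A i =
      (∑ i ∈ Finset.range (n + 1), auxB m δ i n * A i) * _
    rw [Finset.sum_range_succ']
    have h1 : ∑ i ∈ Finset.range (n + 1), auxB m δ (i + 1) (n + 1) * A (i + 1) =
        ∑ i ∈ Finset.range (n + 1),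
          (auxB m δ (i + 1) n * (auxf δ (m + n + 1) - auxf δ ((i + 1 : ℕ) : ℝ)) * A (i + 1)
            - auxB m δ i n * A (i + 1)) := by
      refine Finset.sum_congr rfl fun i hi => ?_
      rw [auxB_succ m δ n i (by have := Finset.mem_range.1 hi; omega)]
      ring
    rw [h1, Finset.sum_sub_distrib, auxB_zero]
    have h2 := Finset.sum_range_succ'
      (fun i => auxB m δ i n * (auxf δ (m + n + 1) - auxf δ (i : ℝ)) * A i) (n + 1)
    rw [Finset.sum_range_succ] at h2
    have h3 : auxB m δ (n + 1) n = 0 := by simp [auxB]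
    simp only [h3, zero_mul, add_zero, Nat.cast_zero] at h2
    have h4 : ∑ i ∈ Finset.range (n + 1), auxB m δ i n * A (i + 1) =
        ∑ i ∈ Finset.range (n + 1), auxB m δ i n * (auxf δ k - auxf δ (i : ℝ)) * A i := by
      refine Finset.sum_congr rfl fun i _ => ?_
      rw [hAs]; ring
    rw [h4, sub_add_eq_add_sub, ← h2, ← Finset.sum_sub_distrib, Finset.sum_mul]
    refine Finset.sum_congr rfl fun i _ => ?_
    ring

/-- **Lemma C.1 (a hypergeometric identity).** For nonnegative integers `m, n, k`
and `δ ≤ 0`,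
`Σ_{i=0}^{n} (−1)^i C(n,i) ((k)_i/(m+n)_i) (∏_{j=k−1}^{k+i−2}(1−jδ)/∏_{j=m}^{m+i−1}(1−jδ))
 = (m+n−k)_n ∏_{j=m+k}^{m+n+k−1}(1−jδ) / ((m+n)_n ∏_{j=m}^{m+n−1}(1−jδ))`. -/
theorem hypergeometric_identity (m n k : ℕ) (δ : ℝ) (hδ : δ ≤ 0) :
    ∑ i ∈ Finset.range (n + 1),
        (-1 : ℝ) ^ i * (n.choose i : ℝ) * (fall (k : ℝ) i / fall ((m : ℝ) + n) i) *
          (pp δ ((k : ℝ) - 1) i / pp δ (m : ℝ) i) =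
      fall ((m : ℝ) + n - k) n * pp δ ((m : ℝ) + k) n /
        (fall ((m : ℝ) + n) n * pp δ (m : ℝ) n) := by
  have hpp : ∀ r, pp δ (m : ℝ) r ≠ 0 := by
    intro r
    refine Finset.prod_ne_zero_iff.2 fun j _ => ?_
    have : (0 : ℝ) ≤ (m : ℝ) + j := by positivity
    have := mul_nonpos_of_nonneg_of_nonpos this hδ
    linarith
  have hfn : fall ((m : ℝ) + n) n ≠ 0 := by
    rw [aux_fall_rise]
    refine Finset.prod_ne_zero_iff.2 fun j _ => ?_
    positivity
  rw [eq_div_iff (mul_ne_zero hfn (hpp n)), Finset.sum_mul]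
  have hR : fall ((m : ℝ) + n - k) n * pp δ ((m : ℝ) + k) n =
      ∏ j ∈ Finset.range n, (auxf δ ((m : ℝ) + j + 1) - auxf δ k) := by
    rw [show (m : ℝ) + n - k = (m - k) + n by ring, aux_fall_rise]
    unfold rise pp auxf
    rw [← Finset.prod_mul_distrib]
    refine Finset.prod_congr rfl fun j _ => ?_
    ring
  rw [hR, ← aux_main]
  refine Finset.sum_congr rfl fun i hi => ?_
  obtain ⟨r, rfl⟩ : ∃ r, n = i + r :=
    ⟨n - i, by have := Finset.mem_range.1 hi; omega⟩
  have hf : fall ((m : ℝ) + (i + r : ℕ)) (i + r) =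
      fall ((m : ℝ) + (i + r : ℕ)) i * rise ((m : ℝ) + 1) r := by
    rw [aux_fall_add, ← aux_fall_rise]
    congr 2
    push_cast; ring
  have hfi : fall ((m : ℝ) + (i + r : ℕ)) i ≠ 0 := by
    intro h
    rw [hf, h, zero_mul] at hfn
    exact hfn rfl
  have hpi := hpp i
  rw [hf, aux_pp_add, auxB, Nat.add_sub_cancel_left]
  field_simp


end
end

section
/- Let m, n be nonnegative integers with n ≥ 1 and let δ be a real number. Let A_{m,n} be the n×n real matrix whose (r,c)-entry (for r, c ∈ {1, …, n}) is (m+r)_c · ∏_{j=m+r−1}^{m+r+c−2}(1−jδ). Then det(A_{m,n}) = (m+n)_n · (∏_{j=0}^{n−1} j!) · (∏_{j=m}^{m+n−1}(1−jδ)) · ∏_{t=1}^{n−1} ∏_{j=m+1}^{m+n−t}(1−(2j+t−1)δ); in particular det(A_{m,n}) ≠ 0 when δ ≤ 0. -/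
open MeasureTheory ProbabilityTheory Finset Filter

noncomputable section

/-- The substitution variable `y = x - δ x (x+1)`. -/
def yy (δ x : ℝ) : ℝ := x - δ * (x * (x + 1))

/-- Monic polynomials giving the matrix entries in the variable `y`. -/
def ppoly (δ : ℝ) (c : ℕ) : Polynomial ℝ :=
  ∏ j ∈ Finset.range c,
    (Polynomial.X - Polynomial.C ((j : ℝ) - δ * ((j : ℝ) * ((j : ℝ) + 1))))

theorem ppoly_monic (δ : ℝ) (c : ℕ) : (ppoly δ c).Monic :=
  Polynomial.monic_prod_of_monic _ _ fun _ _ => Polynomial.monic_X_sub_C _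

theorem ppoly_natDegree (δ : ℝ) (c : ℕ) : (ppoly δ c).natDegree = c := by
  unfold ppoly
  rw [Polynomial.natDegree_prod_of_monic _ _ fun _ _ => Polynomial.monic_X_sub_C _]
  simp only [Polynomial.natDegree_X_sub_C, Finset.sum_const, Finset.card_range, smul_eq_mul,
    mul_one]

theorem entry_eq (δ x : ℝ) (c : ℕ) :
    fall (x + 1) (c + 1) * pp δ x (c + 1) =
      ((x + 1) * (1 - x * δ)) * (ppoly δ c).eval (yy δ x) := by
  unfold fall pp ppoly yy
  rw [Polynomial.eval_prod, ← Finset.prod_mul_distrib, Finset.prod_range_succ', mul_comm]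
  congr 1
  · push_cast; ring
  · refine Finset.prod_congr rfl fun j _ => ?_
    simp only [Polynomial.eval_sub, Polynomial.eval_X, Polynomial.eval_C]
    push_cast
    ring

theorem fall_eq (m n : ℕ) :
    fall ((m : ℝ) + n) n = ∏ r : Fin n, ((m : ℝ) + (r : ℕ) + 1) := by
  unfold fall
  rw [Fin.prod_univ_eq_prod_range (fun r : ℕ => (m : ℝ) + r + 1) n, ← Finset.prod_range_reflect]
  refine Finset.prod_congr rfl fun j hj => ?_
  have h : n = (n - 1 - j) + j + 1 := by have := Finset.mem_range.1 hj; omega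
  have h' : (n : ℝ) = ((n - 1 - j : ℕ) : ℝ) + j + 1 := by exact_mod_cast h
  rw [h']; ring

theorem pairs_eq (m n : ℕ) (δ : ℝ) :
    ∏ i : Fin n, ∏ j ∈ Finset.Ioi i, (1 - δ * (2 * (m : ℝ) + (i : ℕ) + (j : ℕ) + 1)) =
      ∏ t ∈ Finset.Icc 1 (n - 1), ∏ j ∈ Finset.Icc (m + 1) (m + n - t),
          (1 - (2 * (j : ℝ) + (t : ℝ) - 1) * δ) := by
  rw [Finset.prod_sigma', Finset.prod_sigma']
  refine Finset.prod_bij (fun p _ => ⟨(p.2 : ℕ) - (p.1 : ℕ), m + 1 + (p.1 : ℕ)⟩) ?_ ?_ ?_ ?_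
  · rintro ⟨i, j⟩ h
    simp only [Finset.mem_sigma, Finset.mem_univ, Finset.mem_Ioi, true_and, Fin.lt_def] at h
    simp only [Finset.mem_sigma, Finset.mem_Icc]
    have := j.2
    omega
  · rintro ⟨i, j⟩ h ⟨i', j'⟩ h' e
    simp only [Finset.mem_sigma, Finset.mem_univ, Finset.mem_Ioi, true_and, Fin.lt_def] at h h'
    simp only [Sigma.mk.injEq, heq_eq_eq] at e
    have h1 : i = i' := Fin.ext (by omega)
    have h2 : j = j' := Fin.ext (by omega)
    subst h1 h2
    rfl
  · rintro ⟨t, j⟩ h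
    simp only [Finset.mem_sigma, Finset.mem_Icc] at h
    refine ⟨⟨⟨j - (m + 1), by omega⟩, ⟨j - (m + 1) + t, by omega⟩⟩, ?_, ?_⟩
    · simp only [Finset.mem_sigma, Finset.mem_univ, Finset.mem_Ioi, true_and, Fin.lt_def]
      omega
    · simp only [Sigma.mk.injEq, heq_eq_eq]
      omega
  · rintro ⟨i, j⟩ h
    simp only [Finset.mem_sigma, Finset.mem_univ, Finset.mem_Ioi, true_and, Fin.lt_def] at h
    simp only
    rw [Nat.cast_sub h.le]
    push_cast
    ring

theorem fact_eq (n : ℕ) (hn : 1 ≤ n) :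
    ∏ i : Fin n, ∏ j ∈ Finset.Ioi i, (((j : ℕ) : ℝ) - ((i : ℕ) : ℝ)) =
      ∏ j ∈ Finset.range n, (j.factorial : ℝ) := by
  obtain ⟨k, rfl⟩ : ∃ k, n = k + 1 := ⟨n - 1, by omega⟩
  have h := Matrix.det_vandermonde_id_eq_superFactorial (R := ℝ) k
  rw [Matrix.det_vandermonde] at h
  rw [h, ← Nat.prod_range_succ_factorial]
  push_cast
  rfl

theorem det_eq (m n : ℕ) (hn : 1 ≤ n) (δ : ℝ) :
    Matrix.det (fun r c : Fin n =>
      fall ((m : ℝ) + (r : ℕ) + 1) ((c : ℕ) + 1) * pp δ ((m : ℝ) + (r : ℕ)) ((c : ℕ) + 1)) =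
      fall ((m : ℝ) + n) n * (∏ j ∈ Finset.range n, (j.factorial : ℝ)) *
        pp δ (m : ℝ) n *
        ∏ t ∈ Finset.Icc 1 (n - 1), ∏ j ∈ Finset.Icc (m + 1) (m + n - t),
          (1 - (2 * (j : ℝ) + (t : ℝ) - 1) * δ) := by
  simp only [entry_eq]
  have h1 := Matrix.det_mul_column
    (fun r : Fin n => ((m : ℝ) + (r : ℕ) + 1) * (1 - ((m : ℝ) + (r : ℕ)) * δ))
    (Matrix.of fun r c : Fin n => (ppoly δ (c : ℕ)).eval (yy δ ((m : ℝ) + (r : ℕ))))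
  have h2 := Matrix.det_eval_matrixOfPolynomials_eq_det_vandermonde
    (fun r : Fin n => yy δ ((m : ℝ) + (r : ℕ))) (fun c : Fin n => ppoly δ (c : ℕ))
    (fun c => ppoly_natDegree δ c) (fun c => ppoly_monic δ c)
  refine h1.trans ?_
  rw [← h2, Matrix.det_vandermonde, Finset.prod_mul_distrib, ← fall_eq, ← fact_eq n hn,
    ← pairs_eq]
  have h3 : pp δ (m : ℝ) n = ∏ r : Fin n, (1 - ((m : ℝ) + (r : ℕ)) * δ) :=
    (Fin.prod_univ_eq_prod_range (fun r : ℕ => 1 - ((m : ℝ) + r) * δ) n).symm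
  have h4 : ∏ i : Fin n, ∏ j ∈ Finset.Ioi i,
      (yy δ ((m : ℝ) + (j : ℕ)) - yy δ ((m : ℝ) + (i : ℕ))) =
      (∏ i : Fin n, ∏ j ∈ Finset.Ioi i, (((j : ℕ) : ℝ) - ((i : ℕ) : ℝ))) *
      ∏ i : Fin n, ∏ j ∈ Finset.Ioi i, (1 - δ * (2 * (m : ℝ) + (i : ℕ) + (j : ℕ) + 1)) := by
    simp only [← Finset.prod_mul_distrib]
    refine Finset.prod_congr rfl fun i _ => Finset.prod_congr rfl fun j _ => ?_
    unfold yy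
    ring
  rw [h4, h3]
  ring

/-- **Appendix B: the determinant of `A_{m,n}`.** For `n ≥ 1`,
`det A_{m,n} = (m+n)_n (∏_{j=0}^{n−1} j!) (∏_{j=m}^{m+n−1}(1−jδ))
  ∏_{t=1}^{n−1} ∏_{j=m+1}^{m+n−t}(1−(2j+t−1)δ)`,
and in particular `det A_{m,n} ≠ 0` when `δ ≤ 0`. -/
theorem pearson_system_det (m n : ℕ) (hn : 1 ≤ n) (δ : ℝ) :
    let A : Matrix (Fin n) (Fin n) ℝ := fun r c =>
      fall ((m : ℝ) + (r : ℕ) + 1) ((c : ℕ) + 1) * pp δ ((m : ℝ) + (r : ℕ)) ((c : ℕ) + 1)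
    A.det =
      fall ((m : ℝ) + n) n * (∏ j ∈ Finset.range n, (j.factorial : ℝ)) *
        pp δ (m : ℝ) n *
        ∏ t ∈ Finset.Icc 1 (n - 1), ∏ j ∈ Finset.Icc (m + 1) (m + n - t),
          (1 - (2 * (j : ℝ) + (t : ℝ) - 1) * δ) ∧
      (δ ≤ 0 → A.det ≠ 0) := by
  intro A
  have hA : A.det = _ := det_eq m n hn δ
  refine ⟨hA, fun hδ => ?_⟩
  rw [hA]
  have hpos : ∀ a : ℝ, 0 ≤ a → 0 < 1 - a * δ := fun a ha => by
    have := mul_nonneg ha (neg_nonneg.2 hδ)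
    linarith
  apply ne_of_gt
  refine mul_pos (mul_pos (mul_pos ?_ ?_) ?_) ?_
  · rw [fall_eq]
    exact Finset.prod_pos fun r _ => by positivity
  · exact Finset.prod_pos fun r _ => by exact_mod_cast Nat.factorial_pos r
  · exact Finset.prod_pos fun r _ => hpos _ (by positivity)
  · refine Finset.prod_pos fun t ht => Finset.prod_pos fun j _ => hpos _ ?_
    have h1 : (1 : ℝ) ≤ t := by exact_mod_cast (Finset.mem_Icc.1 ht).1
    have h2 : (0 : ℝ) ≤ j := Nat.cast_nonneg j
    linarith

end
end
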